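/- arXiv:1604.07350 — 3 statements merged into one kernel-verified Lean document; each statement's English description precedes it below -/
import Mathlib

section
/- For every real κ > 0 that is not an even integer, and every real θ ≠ 0, the improper integral lim_{T→∞} ∫₀^T x^{−κ} ( sin(θx) − Σ_{0 ≤ j < (κ−2)/2} (−1)^j (θx)^{2j+1}/(2j+1)! ) dx exists and equals S(κ)·sign(θ)·|θ|^{κ−1}, where S(κ) = (π/2)/(Γ(κ) sin(πκ/2)); moreover, when κ is not an integer, S(κ) = Γ(1−κ) cos(πκ/2). -/
open MeasureTheory Filter Real

/-- The Tonelli theorem on the positive quadrant, for a nonnegative kernel whose two marginals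
are known. -/
lemma integrableOn_and_integral_eq_of_marginals {F : ℝ → ℝ → ℝ} {g h : ℝ → ℝ}
    (hF : Measurable (Function.uncurry F))
    (hnonneg : ∀ x, 0 < x → ∀ t, 0 < t → 0 ≤ F x t)
    (hg : ∀ x, 0 < x → ∫ t in Set.Ioi 0, F x t = g x)
    (hFint : ∀ t, 0 < t → IntegrableOn (fun x => F x t) (Set.Ioi 0))
    (hh : ∀ t, 0 < t → ∫ x in Set.Ioi 0, F x t = h t)
    (hhint : IntegrableOn h (Set.Ioi 0)) :
    IntegrableOn g (Set.Ioi 0) ∧ ∫ x in Set.Ioi 0, g x = ∫ t in Set.Ioi 0, h t := by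
  have hprod : Integrable (Function.uncurry F)
      ((volume.restrict (Set.Ioi 0)).prod (volume.restrict (Set.Ioi 0))) := by
    rw [integrable_prod_iff' hF.aestronglyMeasurable]
    refine ⟨?_, ?_⟩
    · filter_upwards [ae_restrict_mem measurableSet_Ioi] with t ht using hFint t ht
    · refine Integrable.congr hhint ?_
      filter_upwards [ae_restrict_mem measurableSet_Ioi] with t ht
      rw [← hh t ht]
      refine setIntegral_congr_fun measurableSet_Ioi fun x hx => ?_
      exact (Real.norm_of_nonneg (hnonneg x hx t ht)).symm
  refine ⟨?_, ?_⟩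
  · refine Integrable.congr hprod.integral_prod_left ?_
    filter_upwards [ae_restrict_mem measurableSet_Ioi] with x hx using hg x hx
  · rw [← setIntegral_congr_fun measurableSet_Ioi fun x hx => hg x hx,
      ← setIntegral_congr_fun measurableSet_Ioi fun t ht => hh t ht]
    exact integral_integral_swap hprod

lemma integrableOn_and_integral_rpow_div_one_add_sq {a : ℝ} (ha0 : 0 < a) (ha2 : a < 2) :
    IntegrableOn (fun t : ℝ => t ^ (a - 1) / (1 + t ^ 2)) (Set.Ioi 0) ∧
      ∫ t in Set.Ioi (0 : ℝ), t ^ (a - 1) / (1 + t ^ 2) = (π / 2) / sin (π * a / 2) := by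
  have hGamma : IntegrableOn (fun y : ℝ => (exp (-y) * y ^ ((1 - a / 2) - 1)) *
      (Gamma (a / 2) / 2)) (Set.Ioi 0) :=
    (GammaIntegral_convergent (by linarith)).mul_const _
  have key := integrableOn_and_integral_eq_of_marginals
    (F := fun t y => t ^ (a - 1) * exp (-(y * (1 + t ^ 2))))
    (g := fun t : ℝ => t ^ (a - 1) / (1 + t ^ 2))
    (h := fun y => (exp (-y) * y ^ ((1 - a / 2) - 1)) * (Gamma (a / 2) / 2))
    (by unfold Function.uncurry; fun_prop) (fun x hx t ht => by positivity) ?_ ?_ ?_ hGamma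
  · refine ⟨key.1, key.2.trans ?_⟩
    rw [integral_mul_const, ← Gamma_eq_integral (by linarith)]
    have := Gamma_mul_Gamma_one_sub (a / 2)
    rw [show π * a / 2 = π * (a / 2) by ring]
    linear_combination this / 2
  · intro t ht
    have := integral_rpow_mul_exp_neg_mul_Ioi (a := 1) (r := 1 + t ^ 2) one_pos (by positivity)
    simp only [sub_self, rpow_zero, one_mul, rpow_one, Gamma_one, mul_one] at this
    simp_rw [mul_comm _ (1 + t ^ 2)]
    rw [integral_const_mul, this]
    ring
  · intro y hy
    have := (integrableOn_rpow_mul_exp_neg_mul_rpow (p := 2) (s := a - 1) (b := y)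
      (by linarith) two_pos hy).mul_const (exp (-y))
    refine IntegrableOn.congr_fun this (fun t _ => ?_) measurableSet_Ioi
    simp only [rpow_two]
    rw [mul_assoc, ← exp_add]
    ring_nf
  · intro y hy
    have := integral_rpow_mul_exp_neg_mul_rpow (p := 2) (q := a - 1) (b := y) two_pos
      (by linarith) hy
    calc ∫ t in Set.Ioi (0 : ℝ), t ^ (a - 1) * exp (-(y * (1 + t ^ 2)))
        = ∫ t in Set.Ioi (0 : ℝ), (t ^ (a - 1) * exp (-y * t ^ (2 : ℝ))) * exp (-y) := by
          refine setIntegral_congr_fun measurableSet_Ioi fun t _ => ?_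
          simp only [rpow_two]
          rw [mul_assoc, ← exp_add]
          ring_nf
      _ = _ := by
          rw [integral_mul_const, this, show -(a - 1 + 1) / 2 = 1 - a / 2 - 1 by ring,
            show (a - 1 + 1) / 2 = a / 2 by ring]
          ring

/-- The Laplace transform of `1 - cos`. -/
lemma integrableOn_and_integral_exp_mul_one_sub_cos {t : ℝ} (ht : 0 < t) :
    IntegrableOn (fun x : ℝ => exp (-(x * t)) * (1 - cos x)) (Set.Ioi 0) ∧
      ∫ x in Set.Ioi (0 : ℝ), exp (-(x * t)) * (1 - cos x) = 1 / (t * (1 + t ^ 2)) := by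
  have ht2 : 1 + t ^ 2 ≠ 0 := by positivity
  have hderiv : ∀ x ∈ Set.Ici (0 : ℝ), HasDerivAt
      (fun x => exp (-(x * t)) * (-(1 / t) + (t * cos x - sin x) / (1 + t ^ 2)))
      (exp (-(x * t)) * (1 - cos x)) x := by
    intro x _
    have h1 : HasDerivAt (fun x => exp (-(x * t))) (exp (-(x * t)) * (-(1 * t))) x :=
      (((hasDerivAt_id x).mul_const t).neg).exp
    have h2 : HasDerivAt (fun x => -(1 / t) + (t * cos x - sin x) / (1 + t ^ 2))
        ((t * (-sin x) - cos x) / (1 + t ^ 2)) x :=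
      ((((hasDerivAt_cos x).const_mul t).sub (hasDerivAt_sin x)).div_const _).const_add _
    refine (h1.mul h2).congr_deriv ?_
    field_simp
    ring
  have hnonneg : ∀ x ∈ Set.Ioi (0 : ℝ), 0 ≤ exp (-(x * t)) * (1 - cos x) := fun x _ =>
    mul_nonneg (exp_pos _).le (sub_nonneg.2 (cos_le_one x))
  have hexp : Tendsto (fun x : ℝ => exp (-(x * t))) atTop (nhds 0) :=
    tendsto_exp_neg_atTop_nhds_zero.comp (tendsto_id.atTop_mul_const ht)
  have hlim : Tendsto
      (fun x => exp (-(x * t)) * (-(1 / t) + (t * cos x - sin x) / (1 + t ^ 2)))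
      atTop (nhds 0) := by
    refine hexp.zero_mul_isBoundedUnder_le (isBoundedUnder_of ⟨1 / t + (t + 1) / (1 + t ^ 2), ?_⟩)
    intro x
    have hcos := abs_cos_le_one x
    have hsin := abs_sin_le_one x
    simp only [Function.comp, norm_eq_abs]
    refine (abs_add_le _ _).trans ?_
    rw [abs_neg, abs_of_pos (by positivity : 0 < 1 / t), abs_div,
      abs_of_pos (by positivity : 0 < 1 + t ^ 2)]
    gcongr
    refine (abs_sub _ _).trans ?_
    rw [abs_mul, abs_of_pos ht]
    nlinarith
  refine ⟨integrableOn_Ioi_deriv_of_nonneg' hderiv hnonneg hlim, ?_⟩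
  rw [integral_Ioi_of_hasDerivAt_of_nonneg' hderiv hnonneg hlim]
  simp
  field_simp
  ring

lemma integrableOn_and_integral_rpow_mul_one_sub_cos {κ : ℝ} (h1 : 1 < κ) (h3 : κ < 3) :
    IntegrableOn (fun x : ℝ => x ^ (-κ) * (1 - cos x)) (Set.Ioi 0) ∧
      ∫ x in Set.Ioi (0 : ℝ), x ^ (-κ) * (1 - cos x) =
        (π / 2) / (Gamma κ * sin (π * (κ - 1) / 2)) := by
  have hΓ : Gamma κ ≠ 0 := (Gamma_pos_of_pos (by linarith)).ne'
  obtain ⟨hint, hval⟩ := integrableOn_and_integral_rpow_div_one_add_sq (a := κ - 1)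
    (by linarith) (by linarith)
  have key := integrableOn_and_integral_eq_of_marginals
    (F := fun x t => t ^ (κ - 1) * (exp (-(x * t)) * (1 - cos x)))
    (g := fun x : ℝ => Gamma κ * (x ^ (-κ) * (1 - cos x)))
    (h := fun t => t ^ (κ - 1 - 1) / (1 + t ^ 2))
    (by unfold Function.uncurry; fun_prop)
    (fun x hx t ht => mul_nonneg (by positivity)
      (mul_nonneg (exp_pos _).le (sub_nonneg.2 (cos_le_one x)))) ?_ ?_ ?_ hint
  · refine ⟨?_, ?_⟩
    · refine IntegrableOn.congr_fun (key.1.const_mul (Gamma κ)⁻¹) (fun x _ => ?_) measurableSet_Ioi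
      field_simp
    · have := key.2
      rw [integral_const_mul, hval] at this
      rw [mul_comm (Gamma κ), ← div_div, ← this]
      field_simp
  · intro x hx
    have := integral_rpow_mul_exp_neg_mul_Ioi (a := κ) (r := x) (by linarith) hx
    simp_rw [← mul_assoc]
    rw [integral_mul_const, this, one_div, inv_rpow hx.le, ← rpow_neg hx.le]
    ring
  · intro t ht
    exact (integrableOn_and_integral_exp_mul_one_sub_cos ht).1.const_mul _
  · intro t ht
    rw [integral_const_mul, (integrableOn_and_integral_exp_mul_one_sub_cos ht).2,
      rpow_sub_one ht.ne' (κ - 1)]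
    field_simp

/-- The iterated primitives of `cos` vanishing at `0`; up to sign, the remainders of the Maclaurin
series of `cos` (even index) and `sin` (odd index). -/
noncomputable def cosPrimitive : ℕ → ℝ → ℝ
  | 0 => cos
  | m + 1 => fun x => ∫ y in (0 : ℝ)..x, cosPrimitive m y

lemma continuous_cosPrimitive (m : ℕ) : Continuous (cosPrimitive m) := by
  induction m with
  | zero => exact continuous_cos
  | succ m ih =>
    exact continuous_iff_continuousAt.2 fun x =>
      (ih.integral_hasStrictDerivAt 0 x).hasDerivAt.continuousAt

lemma hasDerivAt_cosPrimitive_succ (m : ℕ) (x : ℝ) :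
    HasDerivAt (cosPrimitive (m + 1)) (cosPrimitive m x) x :=
  ((continuous_cosPrimitive m).integral_hasStrictDerivAt 0 x).hasDerivAt

lemma cosPrimitive_succ_zero (m : ℕ) : cosPrimitive (m + 1) 0 = 0 :=
  intervalIntegral.integral_same

lemma cosPrimitive_one (x : ℝ) : cosPrimitive 1 x = sin x := by
  simp [cosPrimitive]

lemma cosPrimitive_two (x : ℝ) : cosPrimitive 2 x = 1 - cos x := by
  rw [cosPrimitive]
  simp [cosPrimitive_one]

lemma cosPrimitive_add_two (m : ℕ) (x : ℝ) :
    cosPrimitive (m + 2) x = x ^ m / (m.factorial : ℝ) - cosPrimitive m x := by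
  induction m generalizing x with
  | zero => simp [cosPrimitive]
  | succ m ih =>
    rw [cosPrimitive]
    simp_rw [ih]
    rw [intervalIntegral.integral_sub
      ((by fun_prop : Continuous fun y : ℝ => y ^ m / (m.factorial : ℝ)).intervalIntegrable _ _)
      ((continuous_cosPrimitive m).intervalIntegrable _ _), intervalIntegral.integral_div,
      integral_pow, cosPrimitive, Nat.factorial_succ]
    push_cast
    field_simp
    simp

lemma cosPrimitive_odd (n : ℕ) (x : ℝ) :
    cosPrimitive (2 * n + 1) x = (-1) ^ n * (sin x -
      ∑ j ∈ Finset.range n, (-1 : ℝ) ^ j * x ^ (2 * j + 1) / ((2 * j + 1).factorial : ℝ)) := by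
  induction n with
  | zero => simp [cosPrimitive_one]
  | succ n ih =>
    rw [show 2 * (n + 1) + 1 = 2 * n + 1 + 2 by ring, cosPrimitive_add_two, ih,
      Finset.sum_range_succ]
    have : ((-1 : ℝ) ^ n) * (-1) ^ n = 1 := by rw [← mul_pow]; simp
    linear_combination -(x ^ (2 * n + 1) / ((2 * n + 1).factorial : ℝ)) * this

lemma abs_cosPrimitive_le (m : ℕ) {x : ℝ} (hx : 0 ≤ x) : |cosPrimitive m x| ≤ x ^ m := by
  induction m generalizing x with
  | zero => simpa [cosPrimitive] using abs_cos_le_one x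
  | succ m ih =>
    have := norm_image_sub_le_of_norm_deriv_le_segment' (a := 0) (b := x) (C := x ^ m)
      (fun y _ => (hasDerivAt_cosPrimitive_succ m y).hasDerivWithinAt)
      (fun y hy => (ih hy.1).trans (pow_le_pow_left₀ hy.1 hy.2.le m)) x ⟨hx, le_rfl⟩
    simpa [cosPrimitive_succ_zero, pow_succ] using this

lemma abs_cosPrimitive_add_two_le (m : ℕ) {x : ℝ} (hx : 0 ≤ x) :
    |cosPrimitive (m + 2) x| ≤ 2 * x ^ m := by
  rw [cosPrimitive_add_two]
  have h1 := abs_cosPrimitive_le m hx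
  have h2 : |x ^ m / (m.factorial : ℝ)| ≤ x ^ m := by
    rw [abs_of_nonneg (by positivity)]
    exact div_le_self (by positivity) (mod_cast m.factorial_pos)
  linarith [abs_sub (x ^ m / (m.factorial : ℝ)) (cosPrimitive m x)]

lemma abs_rpow_mul_cosPrimitive_le (m : ℕ) (s : ℝ) {x : ℝ} (hx : 0 < x) :
    |x ^ s * cosPrimitive m x| ≤ x ^ (s + m) := by
  rw [abs_mul, abs_of_pos (rpow_pos_of_pos hx s), rpow_add hx, rpow_natCast]
  gcongr
  exact abs_cosPrimitive_le m hx.le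

lemma intervalIntegrable_rpow_mul_cosPrimitive {m : ℕ} {s : ℝ} (hs : -1 < s + m) {T : ℝ}
    (hT : 0 ≤ T) : IntervalIntegrable (fun x => x ^ s * cosPrimitive m x) volume 0 T := by
  refine (intervalIntegral.intervalIntegrable_rpow' hs).mono_fun ?_ ?_
  · exact ((measurable_id.pow_const s).mul
      (continuous_cosPrimitive m).measurable).aestronglyMeasurable
  · rw [Set.uIoc_of_le hT]
    filter_upwards [ae_restrict_mem measurableSet_Ioc] with x hx
    exact (abs_rpow_mul_cosPrimitive_le m s hx.1).trans (le_abs_self _)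

lemma continuousOn_rpow_mul_cosPrimitive_succ {m : ℕ} {s : ℝ} (hs : 0 < s + (m + 1 : ℕ)) :
    ContinuousOn (fun x => x ^ s * cosPrimitive (m + 1) x) (Set.Ici 0) := by
  intro x hx
  rcases (Set.mem_Ici.1 hx).eq_or_lt with rfl | hx
  · have hlim : Tendsto (fun x : ℝ => x ^ (s + (m + 1 : ℕ))) (nhdsWithin 0 (Set.Ici 0))
        (nhds 0) := by
      have := (continuousAt_rpow_const (0 : ℝ) _ (Or.inr hs.le)).tendsto
      rw [zero_rpow hs.ne'] at this
      exact this.mono_left nhdsWithin_le_nhds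
    rw [ContinuousWithinAt, cosPrimitive_succ_zero, mul_zero]
    refine squeeze_zero_norm' ?_ hlim
    filter_upwards [self_mem_nhdsWithin] with y hy
    rcases (Set.mem_Ici.1 hy).eq_or_lt with rfl | hy
    · simp [cosPrimitive_succ_zero, zero_rpow hs.ne', -Nat.cast_add]
    · exact abs_rpow_mul_cosPrimitive_le (m + 1) s hy
  · exact ((continuousAt_rpow_const x s (Or.inl hx.ne')).mul
      (continuous_cosPrimitive _).continuousAt).continuousWithinAt

/-- Integration by parts. -/
lemma integral_rpow_mul_cosPrimitive {m : ℕ} {κ : ℝ} (hm : κ < m + 1) {T : ℝ} (hT : 0 ≤ T) :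
    ∫ x in (0 : ℝ)..T, x ^ (-κ) * cosPrimitive m x =
      T ^ (-κ) * cosPrimitive (m + 1) T +
        κ * ∫ x in (0 : ℝ)..T, x ^ (-(κ + 1)) * cosPrimitive (m + 1) x := by
  have hint := intervalIntegrable_rpow_mul_cosPrimitive (m := m) (s := -κ) (by linarith) hT
  have hint' := intervalIntegrable_rpow_mul_cosPrimitive (m := m + 1) (s := -(κ + 1))
    (by push_cast; linarith) hT
  have hparts := intervalIntegral.integral_eq_sub_of_hasDerivAt_of_le hT
    ((continuousOn_rpow_mul_cosPrimitive_succ (m := m) (s := -κ)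
      (by push_cast; linarith)).mono Set.Icc_subset_Ici_self)
    (f' := fun x => x ^ (-κ) * cosPrimitive m x -
      κ * (x ^ (-(κ + 1)) * cosPrimitive (m + 1) x))
    (fun x hx => by
      refine ((hasDerivAt_rpow_const (p := -κ) (Or.inl hx.1.ne')).mul
        (hasDerivAt_cosPrimitive_succ m x)).congr_deriv ?_
      rw [show -κ - 1 = -(κ + 1) by ring]
      ring)
    (hint.sub (hint'.const_mul κ))
  rw [intervalIntegral.integral_sub hint (hint'.const_mul κ),
    intervalIntegral.integral_const_mul, cosPrimitive_succ_zero] at hparts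
  linear_combination hparts

lemma tendsto_rpow_mul_cosPrimitive_add_two {m : ℕ} {κ : ℝ} (hm : (m : ℝ) < κ) :
    Tendsto (fun T : ℝ => T ^ (-κ) * cosPrimitive (m + 2) T) atTop (nhds 0) := by
  have hlim : Tendsto (fun T : ℝ => 2 * T ^ (-(κ - m))) atTop (nhds 0) := by
    simpa using (tendsto_rpow_neg_atTop (sub_pos.2 hm)).const_mul 2
  refine squeeze_zero_norm' ?_ hlim
  filter_upwards [eventually_gt_atTop 0] with T hT
  rw [norm_eq_abs, abs_mul, abs_of_pos (rpow_pos_of_pos hT _),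
    show -(κ - m) = -κ + m by ring, rpow_add hT, rpow_natCast]
  nlinarith [abs_cosPrimitive_add_two_le m hT.le, rpow_pos_of_pos hT (-κ)]

lemma tendsto_integral_rpow_mul_cosPrimitive (m : ℕ) {κ : ℝ} (h0 : (m : ℝ) < κ)
    (h2 : κ < m + 2) :
    Tendsto (fun T : ℝ => ∫ x in (0 : ℝ)..T, x ^ (-κ) * cosPrimitive (m + 1) x) atTop
      (nhds ((π / 2) / (Gamma κ * sin (π * (κ - m) / 2)))) := by
  induction m generalizing κ with
  | zero =>
    have hκ : 0 < κ := by simpa using h0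
    have hκ2 : κ < 2 := by simpa using h2
    obtain ⟨hint, hval⟩ := integrableOn_and_integral_rpow_mul_one_sub_cos (κ := κ + 1)
      (by linarith) (by linarith)
    have hlim := intervalIntegral_tendsto_integral_Ioi 0 hint tendsto_id
    simp_rw [hval, ← cosPrimitive_two] at hlim
    have hsum := (tendsto_rpow_mul_cosPrimitive_add_two h0).add (hlim.const_mul κ)
    have hΓ := (Gamma_pos_of_pos hκ).ne'
    convert hsum.congr' ?_ using 2
    · rw [Gamma_add_one hκ.ne', zero_add, add_sub_cancel_right, Nat.cast_zero, sub_zero]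
      field_simp
    · filter_upwards [eventually_ge_atTop 0] with T hT
      exact (integral_rpow_mul_cosPrimitive (m := 1) (by norm_num; linarith) hT).symm
  | succ m ih =>
    push_cast at h0 h2
    have hm : (0 : ℝ) ≤ m := m.cast_nonneg
    have hκ : 0 < κ - 1 := by linarith
    have hlim := ih (κ := κ - 1) (by linarith) (by linarith)
    have hdiff := (hlim.sub (tendsto_rpow_mul_cosPrimitive_add_two (m := m) (κ := κ - 1)
      (by linarith))).const_mul (κ - 1)⁻¹
    convert hdiff.congr' ?_ using 2
    · have hΓ := Gamma_add_one hκ.ne'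
      rw [sub_add_cancel] at hΓ
      rw [hΓ]
      push_cast
      rw [sub_zero, show κ - (m + 1) = κ - 1 - m by ring]
      field_simp
    · filter_upwards [eventually_ge_atTop 0] with T hT
      rw [integral_rpow_mul_cosPrimitive (m := m + 1) (κ := κ - 1)
        (by push_cast; linarith) hT, sub_add_cancel, add_sub_cancel_left,
        inv_mul_cancel_left₀ hκ.ne']

lemma tendsto_integral_rpow_mul_sin_sub_sum (n : ℕ) {κ : ℝ} (h0 : 2 * (n : ℝ) < κ)
    (h2 : κ < 2 * n + 2) :
    Tendsto (fun T : ℝ => ∫ x in (0 : ℝ)..T, x ^ (-κ) * (sin x -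
        ∑ j ∈ Finset.range n, (-1 : ℝ) ^ j * x ^ (2 * j + 1) / ((2 * j + 1).factorial : ℝ)))
      atTop (nhds ((π / 2) / (Gamma κ * sin (π * κ / 2)))) := by
  have hsq : ((-1 : ℝ) ^ n) * (-1) ^ n = 1 := by rw [← mul_pow]; simp
  have hlim := (tendsto_integral_rpow_mul_cosPrimitive (2 * n) (κ := κ) (by push_cast; linarith)
    (by push_cast; linarith)).const_mul ((-1 : ℝ) ^ n)
  convert hlim using 2
  · rw [← intervalIntegral.integral_const_mul]
    congr 1
    ext x
    rw [cosPrimitive_odd]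
    linear_combination (-(x ^ (-κ) * (sin x - ∑ j ∈ Finset.range n,
      (-1 : ℝ) ^ j * x ^ (2 * j + 1) / ((2 * j + 1).factorial : ℝ)))) * hsq
  · rw [show π * (κ - (2 * n : ℕ)) / 2 = π * κ / 2 - n * π by push_cast; ring,
      sin_sub_nat_mul_pi]
    rcases neg_one_pow_eq_or ℝ n with h | h <;> rw [h] <;> simp [div_neg]

lemma sin_sub_sum_eq_sign_mul (n : ℕ) (θ x : ℝ) :
    sin (θ * x) - ∑ j ∈ Finset.range n,
        (-1 : ℝ) ^ j * (θ * x) ^ (2 * j + 1) / ((2 * j + 1).factorial : ℝ) =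
      Real.sign θ * (sin (|θ| * x) - ∑ j ∈ Finset.range n,
        (-1 : ℝ) ^ j * (|θ| * x) ^ (2 * j + 1) / ((2 * j + 1).factorial : ℝ)) := by
  rcases lt_trichotomy θ 0 with h | rfl | h
  · have hsum : ∑ j ∈ Finset.range n,
          (-1 : ℝ) ^ j * (-(θ * x)) ^ (2 * j + 1) / ((2 * j + 1).factorial : ℝ) =
        -∑ j ∈ Finset.range n,
          (-1 : ℝ) ^ j * (θ * x) ^ (2 * j + 1) / ((2 * j + 1).factorial : ℝ) := by
      rw [← Finset.sum_neg_distrib]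
      refine Finset.sum_congr rfl fun j _ => ?_
      rw [(odd_two_mul_add_one j).neg_pow]
      ring
    rw [sign_of_neg h, abs_of_neg h, neg_mul θ x, sin_neg, hsum]
    ring
  · simp
  · rw [sign_of_pos h, abs_of_pos h, one_mul]

lemma pi_div_two_div_Gamma_mul_sin {κ : ℝ} (hκ : 0 < κ) (hint : ∀ n : ℤ, κ ≠ n) :
    (π / 2) / (Gamma κ * sin (π * κ / 2)) = Gamma (1 - κ) * cos (π * κ / 2) := by
  have hΓ := (Gamma_pos_of_pos hκ).ne'
  have hsin : sin (π * κ) ≠ 0 := by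
    rw [Ne, sin_eq_zero_iff]
    rintro ⟨n, hn⟩
    exact hint n (mul_left_cancel₀ pi_ne_zero (by linarith))
  have hdouble : sin (π * κ) = 2 * sin (π * κ / 2) * cos (π * κ / 2) := by
    rw [← sin_two_mul]
    ring_nf
  have hreflection := Gamma_mul_Gamma_one_sub κ
  rw [eq_div_iff hsin, hdouble] at hreflection
  have hhalf : sin (π * κ / 2) ≠ 0 := fun h => hsin (by rw [hdouble, h]; ring)
  rw [div_eq_iff (mul_ne_zero hΓ hhalf)]
  linear_combination -hreflection / 2

theorem stmt6 (κ : ℝ) (hκ : 0 < κ) (heven : ∀ n : ℕ, κ ≠ 2 * n)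
    (θ : ℝ) (hθ : θ ≠ 0) :
    Tendsto (fun T : ℝ => ∫ x in Set.Ioc (0 : ℝ) T,
        x ^ (-κ) * (Real.sin (θ * x) -
          ∑ j ∈ Finset.range ⌈(κ - 2) / 2⌉₊, (-1 : ℝ) ^ j * (θ * x) ^ (2 * j + 1) /
            (Nat.factorial (2 * j + 1) : ℝ)))
      atTop
      (nhds ((Real.pi / 2) / (Real.Gamma κ * Real.sin (Real.pi * κ / 2)) *
        Real.sign θ * |θ| ^ (κ - 1))) ∧
    ((∀ n : ℤ, κ ≠ n) →
      (Real.pi / 2) / (Real.Gamma κ * Real.sin (Real.pi * κ / 2)) =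
        Real.Gamma (1 - κ) * Real.cos (Real.pi * κ / 2)) := by
  refine ⟨?_, pi_div_two_div_Gamma_mul_sin hκ⟩
  have hle : κ ≤ 2 * (⌈(κ - 2) / 2⌉₊ : ℝ) + 2 := by linarith [Nat.le_ceil ((κ - 2) / 2)]
  have hlower : 2 * (⌈(κ - 2) / 2⌉₊ : ℝ) < κ := by
    rcases le_or_gt ((κ - 2) / 2) 0 with h | h
    · simpa [Nat.ceil_eq_zero.2 h] using hκ
    · linarith [Nat.ceil_lt_add_one h.le]
  set n := ⌈(κ - 2) / 2⌉₊
  have hupper : κ < 2 * n + 2 := hle.lt_of_ne fun h => heven (n + 1) (by push_cast; linarith)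
  have habs : 0 < |θ| := abs_pos.2 hθ
  have hlim := ((tendsto_integral_rpow_mul_sin_sub_sum n hlower hupper).comp
    (tendsto_id.const_mul_atTop habs)).mul_const (Real.sign θ * |θ| ^ (κ - 1))
  rw [mul_assoc]
  refine hlim.congr' ?_
  filter_upwards [eventually_ge_atTop 0] with T hT
  have hscale := intervalIntegral.integral_comp_mul_left (a := 0) (b := T)
    (fun x => x ^ (-κ) * (sin x - ∑ j ∈ Finset.range n,
      (-1 : ℝ) ^ j * x ^ (2 * j + 1) / ((2 * j + 1).factorial : ℝ))) habs.ne'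
  rw [mul_zero, smul_eq_mul, eq_inv_mul_iff_mul_eq₀ habs.ne'] at hscale
  rw [Function.comp_apply, id, ← hscale, ← intervalIntegral.integral_of_le hT,
    ← intervalIntegral.integral_const_mul, ← intervalIntegral.integral_mul_const]
  refine intervalIntegral.integral_congr fun x hx => ?_
  rw [Set.uIcc_of_le hT] at hx
  have hpow : |θ| * |θ| ^ (-κ) * |θ| ^ (κ - 1) = 1 := by
    rw [mul_assoc, ← rpow_add habs, show -κ + (κ - 1) = -1 by ring, rpow_neg_one,
      mul_inv_cancel₀ habs.ne']
  rw [sin_sub_sum_eq_sign_mul n θ x, mul_rpow habs.le hx.1]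
  linear_combination (x ^ (-κ) * (Real.sign θ * (sin (|θ| * x) - ∑ j ∈ Finset.range n,
    (-1 : ℝ) ^ j * (|θ| * x) ^ (2 * j + 1) / ((2 * j + 1).factorial : ℝ)))) * hpow
end

section
/- Let 0 < α ≤ 2 with α ≠ 1, let c > 0, γ ∈ ℝ, c' ∈ ℝ, and suppose the function φ(t) = exp( i γ t − c |t|^α (1 − i c' sign(t)) ) is the characteristic function of some probability measure on ℝ. Then: if 0 < α < 2, one has |c'| ≤ |tan(πα/2)| (i.e. c' = β tan(πα/2) for some β ∈ [−1, 1]); and if α = 2, then c' = 0. -/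
open MeasureTheory Complex Filter
open scoped Topology

/-- The characteristic function of a measure on ℝ. -/
noncomputable def charFun' (μ : Measure ℝ) (t : ℝ) : ℂ :=
  ∫ x, Complex.exp (Complex.I * t * x) ∂μ

lemma integrableOn_rpow_mul_exp_neg_mul {a b : ℝ} (ha : 0 < a) (hb : 0 < b) :
    IntegrableOn (fun t : ℝ => t ^ (a - 1) * Real.exp (-(b * t))) (Set.Ioi 0) := by
  simpa using integrableOn_rpow_mul_exp_neg_mul_rpow (p := 1) (s := a - 1) (by linarith) one_pos hb

lemma norm_cexp_neg_mul_ofReal (r : ℂ) (t : ℝ) : ‖cexp (-(r * t))‖ = Real.exp (-(r.re * t)) := by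
  simp [Complex.norm_exp]

lemma differentiableAt_laplace_rpow {a : ℝ} (ha : 0 < a) {r : ℂ} (hr : 0 < r.re) :
    DifferentiableAt ℂ
      (fun z : ℂ => ∫ t in Set.Ioi (0 : ℝ), ((t ^ (a - 1) : ℝ) : ℂ) * cexp (-(z * t))) r := by
  have hs : {z : ℂ | r.re / 2 < z.re} ∈ 𝓝 r :=
    (isOpen_lt continuous_const continuous_re).mem_nhds (by simp; linarith)
  have hint := integrableOn_rpow_mul_exp_neg_mul ha hr
  have hmeas : ∀ z : ℂ, AEStronglyMeasurable
      (fun t : ℝ => ((t ^ (a - 1) : ℝ) : ℂ) * cexp (-(z * t)))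
      (volume.restrict (Set.Ioi 0)) := fun z =>
    Measurable.aestronglyMeasurable (by fun_prop)
  refine (hasDerivAt_integral_of_dominated_loc_of_deriv_le (μ := volume.restrict (Set.Ioi 0))
    (F := fun (z : ℂ) (t : ℝ) => ((t ^ (a - 1) : ℝ) : ℂ) * cexp (-(z * t)))
    (F' := fun (z : ℂ) (t : ℝ) => ((t ^ (a - 1) : ℝ) : ℂ) * (cexp (-(z * t)) * -(1 * (t : ℂ))))
    (bound := fun t => t ^ (a + 1 - 1) * Real.exp (-(r.re / 2 * t)))
    hs (Eventually.of_forall hmeas) ?_ ?_ ?_ ?_ ?_).2.differentiableAt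
  · refine hint.mono' (hmeas r) ?_
    filter_upwards [ae_restrict_mem measurableSet_Ioi] with t ht
    have ht : 0 < t := ht
    rw [norm_mul, norm_cexp_neg_mul_ofReal, Complex.norm_real, Real.norm_of_nonneg (by positivity)]
  · exact Measurable.aestronglyMeasurable (by fun_prop)
  · filter_upwards [ae_restrict_mem measurableSet_Ioi] with t ht z hz
    have ht : 0 < t := ht
    have hz : r.re / 2 < z.re := hz
    rw [norm_mul, norm_mul, norm_cexp_neg_mul_ofReal, Complex.norm_real,
      Real.norm_of_nonneg (by positivity), add_sub_right_comm, Real.rpow_add_one ht.ne', norm_neg,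
      one_mul, Complex.norm_real, Real.norm_of_nonneg ht.le]
    have : Real.exp (-(z.re * t)) ≤ Real.exp (-(r.re / 2 * t)) := by gcongr
    calc _ = t ^ (a - 1) * t * Real.exp (-(z.re * t)) := by ring
      _ ≤ _ := by gcongr
  · exact integrableOn_rpow_mul_exp_neg_mul (by linarith) (by linarith)
  · filter_upwards with t z _
    exact (((hasDerivAt_id z).mul_const (t : ℂ)).neg.cexp).const_mul _

/-- The Laplace transform of `t ^ (a - 1)` at a complex point of the right half-plane. -/
lemma integral_rpow_mul_cexp_neg_mul {a : ℝ} (ha : 0 < a) {r : ℂ} (hr : 0 < r.re) :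
    ∫ t in Set.Ioi (0 : ℝ), ((t ^ (a - 1) : ℝ) : ℂ) * cexp (-(r * t)) =
      Real.Gamma a * r ^ (-a : ℂ) := by
  set U : Set ℂ := {z : ℂ | 0 < z.re}
  have hU : IsOpen U := isOpen_lt continuous_const continuous_re
  have hconv : Convex ℝ U := convex_halfSpace_re_gt 0
  have hf : AnalyticOnNhd ℂ
      (fun z : ℂ => ∫ t in Set.Ioi (0 : ℝ), ((t ^ (a - 1) : ℝ) : ℂ) * cexp (-(z * t))) U :=
    DifferentiableOn.analyticOnNhd
      (fun z hz => (differentiableAt_laplace_rpow ha hz).differentiableWithinAt) hU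
  have hg : AnalyticOnNhd ℂ (fun z : ℂ => (Real.Gamma a : ℂ) * z ^ (-a : ℂ)) U := by
    refine DifferentiableOn.analyticOnNhd (fun z hz => ?_) hU
    exact (((differentiableAt_id).cpow (differentiableAt_const _) (Or.inl hz)).const_mul
      _).differentiableWithinAt
  refine hf.eqOn_of_preconnected_of_frequently_eq hg hconv.isPreconnected
    (z₀ := 1) (by simp [U]) ?_ hr
  have hreal : ∀ x : ℝ, 0 < x →
      ∫ t in Set.Ioi (0 : ℝ), ((t ^ (a - 1) : ℝ) : ℂ) * cexp (-((x : ℂ) * t)) =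
      Real.Gamma a * (x : ℂ) ^ (-a : ℂ) := by
    intro x hx
    have h := Real.integral_rpow_mul_exp_neg_mul_Ioi ha hx
    rw [← ofReal_neg, ← ofReal_cpow hx.le, Real.rpow_neg hx.le, ← ofReal_mul, mul_comm,
      ← Real.inv_rpow hx.le, ← one_div, ← h, ← integral_complex_ofReal]
    simp
  have hseq : Tendsto (fun x : ℝ => (x : ℂ)) (𝓝[≠] 1) (𝓝[≠] 1) := by
    refine tendsto_nhdsWithin_iff.2 ⟨?_, ?_⟩
    · exact (continuous_ofReal.tendsto' 1 1 (by simp)).mono_left nhdsWithin_le_nhds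
    · filter_upwards [self_mem_nhdsWithin] with x hx
      simpa using hx
  refine hseq.frequently (Eventually.frequently ?_)
  filter_upwards [nhdsWithin_le_nhds (Ioi_mem_nhds one_pos)] with x hx
  exact hreal x hx

lemma one_add_I_mul_ofReal_ne_zero (t : ℝ) : (1 + I * t : ℂ) ≠ 0 := by
  intro h
  simpa using congrArg Complex.re h

lemma norm_inv_one_add_I_mul_pow_four (t : ℝ) :
    ‖(((1 + I * t : ℂ)) ^ 4)⁻¹‖ = ((1 + t ^ 2) ^ 2)⁻¹ := by
  have h : ‖(1 + I * t : ℂ)‖ ^ 2 = 1 + t ^ 2 := by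
    rw [← Complex.normSq_eq_norm_sq, Complex.normSq_apply]
    simp
    ring
  rw [norm_inv, norm_pow, ← h]
  ring

lemma continuous_inv_one_add_I_mul_pow_four :
    Continuous fun t : ℝ => (((1 + I * t : ℂ)) ^ 4)⁻¹ :=
  Continuous.inv₀ (by fun_prop) fun t => pow_ne_zero _ (one_add_I_mul_ofReal_ne_zero t)

lemma rpow_mul_inv_one_add_sq_le {α : ℝ} (hα : 0 ≤ α) (hα2 : α ≤ 2) (t : ℝ) :
    |t| ^ α * ((1 + t ^ 2) ^ 2)⁻¹ ≤ (1 + t ^ 2)⁻¹ := by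
  have h : |t| ^ α ≤ 1 + t ^ 2 := by
    rcases le_total |t| 1 with h | h
    · exact (Real.rpow_le_one (abs_nonneg t) h hα).trans (by nlinarith [sq_nonneg t])
    · calc |t| ^ α ≤ |t| ^ (2 : ℝ) := Real.rpow_le_rpow_of_exponent_le h hα2
        _ = t ^ 2 := by simp
        _ ≤ _ := by linarith
  calc |t| ^ α * ((1 + t ^ 2) ^ 2)⁻¹ ≤ (1 + t ^ 2) * ((1 + t ^ 2) ^ 2)⁻¹ := by gcongr
    _ = _ := by field_simp

lemma integrable_rpow_mul_norm_inv_pow_four {α : ℝ} (hα : 0 ≤ α) (hα2 : α ≤ 2) :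
    Integrable fun t : ℝ => |t| ^ α * ‖(((1 + I * t : ℂ)) ^ 4)⁻¹‖ := by
  refine integrable_inv_one_add_sq.mono' ?_ (Eventually.of_forall fun t => ?_)
  · exact Measurable.aestronglyMeasurable (by fun_prop)
  · rw [Real.norm_of_nonneg (by positivity), norm_inv_one_add_I_mul_pow_four]
    exact rpow_mul_inv_one_add_sq_le hα hα2 t

lemma integrable_inv_one_add_I_mul_pow_four :
    Integrable fun t : ℝ => (((1 + I * t : ℂ)) ^ 4)⁻¹ := by
  have h := integrable_rpow_mul_norm_inv_pow_four (α := 0) le_rfl zero_le_two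
  simp only [Real.rpow_zero, one_mul] at h
  exact (integrable_norm_iff
    continuous_inv_one_add_I_mul_pow_four.aestronglyMeasurable).1 h

lemma integrableOn_cube_mul_exp_neg :
    IntegrableOn (fun x : ℝ => x ^ 3 * Real.exp (-x)) (Set.Ioi 0) := by
  refine (integrableOn_rpow_mul_exp_neg_mul (a := 4) (b := 1) (by norm_num)
    one_pos).congr_fun (fun x _ => ?_) measurableSet_Ioi
  have : x ^ ((4 : ℝ) - 1) = x ^ 3 := by rw [← Real.rpow_natCast]; norm_num
  simp only [this, one_mul]

lemma integral_cube_mul_cexp (t : ℝ) :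
    ∫ x in Set.Ioi (0 : ℝ), ((x ^ 3 : ℝ) : ℂ) * cexp (-((1 + I * t) * x)) =
      6 * (((1 + I * t : ℂ)) ^ 4)⁻¹ := by
  have h := integral_rpow_mul_cexp_neg_mul (a := 4) (by norm_num) (r := 1 + I * t) (by simp)
  have h4 : ((1 + I * t : ℂ)) ^ (-((4 : ℝ) : ℂ)) = (((1 + I * t : ℂ)) ^ 4)⁻¹ := by
    rw [cpow_neg, show ((4 : ℝ) : ℂ) = ((4 : ℕ) : ℂ) by norm_num, cpow_natCast]
  have hG : Real.Gamma 4 = 6 := by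
    rw [Real.Gamma_ofNat_eq_factorial]
    norm_num [Nat.factorial]
  rw [h4, hG] at h
  have h3 : ∀ x : ℝ, x ^ ((4 : ℝ) - 1) = x ^ 3 := fun x => by
    rw [← Real.rpow_natCast]; norm_num
  simp only [h3] at h
  simpa using h

lemma integral_cexp_mul_inv_one_add_I_mul_pow_four (x : ℝ) :
    ∫ t : ℝ, cexp (I * t * x) * (((1 + I * t : ℂ)) ^ 4)⁻¹ =
      ((Real.pi / 3 * (max x 0 ^ 3 * Real.exp (-x)) : ℝ) : ℂ) := by
  set f : ℝ → ℂ := fun x => ((max x 0 ^ 3 * Real.exp (-x) : ℝ) : ℂ) with hf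
  have hfc : Continuous f := by fun_prop
  have hfind : f = (Set.Ioi (0 : ℝ)).indicator fun x => ((x ^ 3 * Real.exp (-x) : ℝ) : ℂ) := by
    ext x
    by_cases hx : 0 < x
    · simp [hf, hx, hx.le]
    · simp [hf, hx, max_eq_right (not_lt.1 hx)]
  have hfi : Integrable f := by
    rw [hfind, integrable_indicator_iff measurableSet_Ioi]
    exact integrableOn_cube_mul_exp_neg.ofReal
  have hF : FourierTransform.fourier f =
      fun w : ℝ => 6 * (((1 + I * ((2 * Real.pi * w : ℝ) : ℂ))) ^ 4)⁻¹ := by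
    ext w
    rw [Real.fourier_real_eq_integral_exp_smul, ← integral_cube_mul_cexp, hfind,
      ← integral_indicator measurableSet_Ioi]
    congr 1 with v
    by_cases hv : v ∈ Set.Ioi (0 : ℝ)
    · simp only [Set.indicator_of_mem hv, smul_eq_mul]
      push_cast
      rw [mul_left_comm, ← Complex.exp_add]
      congr 2
      ring
    · simp [Set.indicator_of_notMem hv]
  have hFi : Integrable (FourierTransform.fourier f) := by
    rw [hF]
    exact (integrable_inv_one_add_I_mul_pow_four.comp_mul_left'
      (by positivity : 2 * Real.pi ≠ 0)).const_mul 6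
  have hinv := congrFun (hfc.fourierInv_fourier_eq hfi hFi) x
  rw [Real.fourierInv_eq', hF] at hinv
  have hscale := Measure.integral_comp_mul_left
    (fun t : ℝ => cexp (I * t * x) * (((1 + I * t : ℂ)) ^ 4)⁻¹) (2 * Real.pi)
  have hlhs : ∫ v : ℝ, cexp (((2 * Real.pi * inner ℝ v x : ℝ) : ℂ) * I) •
      (6 * (((1 + I * ((2 * Real.pi * v : ℝ) : ℂ))) ^ 4)⁻¹) =
      6 * ∫ v : ℝ, cexp (I * ((2 * Real.pi * v : ℝ) : ℂ) * x) *
        (((1 + I * ((2 * Real.pi * v : ℝ) : ℂ))) ^ 4)⁻¹ := by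
    rw [← integral_const_mul]
    congr 1 with v
    have : ((2 * Real.pi * inner ℝ v x : ℝ) : ℂ) * I = I * ((2 * Real.pi * v : ℝ) : ℂ) * x := by
      simp
      ring
    rw [this, smul_eq_mul]
    ring
  rw [hlhs, hscale, abs_of_pos (by positivity), Complex.real_smul] at hinv
  have hpi : (Real.pi : ℂ) ≠ 0 := by exact_mod_cast Real.pi_ne_zero
  have key : ∀ z : ℂ, 6 * ((((2 * Real.pi)⁻¹ : ℝ) : ℂ) * z) = f x → z = (Real.pi / 3 : ℂ) * f x := by
    intro z hz
    rw [← hz]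
    push_cast
    field_simp
    ring
  rw [key _ hinv, hf]
  push_cast
  ring

lemma I_mul_ofReal_cpow {x : ℝ} (hx : 0 < x) (p : ℝ) :
    (I * x : ℂ) ^ (p : ℂ) = ((x ^ p : ℝ) : ℂ) * cexp ((Real.pi * p / 2 : ℝ) * I) := by
  have hx' : (x : ℂ) ≠ 0 := by exact_mod_cast hx.ne'
  rw [mul_comm, cpow_def_of_ne_zero (mul_ne_zero hx' I_ne_zero), log_ofReal_mul hx I_ne_zero, log_I,
    add_mul, Complex.exp_add, Real.rpow_def_of_pos hx]
  push_cast
  congr 2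
  ring

lemma integral_rpow_mul_cexp_mul_inv_one_add_I_mul_pow_four {α ε : ℝ} (hα : 0 < α) (hε : 0 < ε) :
    6 * ∫ t in Set.Ioi (0 : ℝ), ((t ^ α * Real.exp (-(ε * t)) : ℝ) : ℂ) *
        (((1 + I * t : ℂ)) ^ 4)⁻¹ =
      Real.Gamma (α + 1) * ∫ x in Set.Ioi (0 : ℝ), ((x ^ 3 * Real.exp (-x) : ℝ) : ℂ) *
        (ε + I * x) ^ ((-(α + 1) : ℝ) : ℂ) := by
  have h1 : IntegrableOn (fun t : ℝ => t ^ α * Real.exp (-(ε * t))) (Set.Ioi 0) := by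
    simpa using integrableOn_rpow_mul_exp_neg_mul (a := α + 1) (by linarith) hε
  have hprod := (Integrable.mul_prod h1 integrableOn_cube_mul_exp_neg).ofReal (𝕜 := ℂ)
  have hint : Integrable (Function.uncurry fun t x : ℝ =>
      ((t ^ α * Real.exp (-(ε * t)) * (x ^ 3 * Real.exp (-x)) : ℝ) : ℂ) * cexp (-(I * t * x)))
      ((volume.restrict (Set.Ioi 0)).prod (volume.restrict (Set.Ioi 0))) := by
    refine hprod.mul_bdd (c := 1) ?_ (Eventually.of_forall fun p => ?_)
    · exact Measurable.aestronglyMeasurable (by fun_prop)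
    · simp [Complex.norm_exp]
  have hswap := integral_integral_swap hint
  rw [← integral_const_mul, ← integral_const_mul]
  convert hswap using 1
  · refine setIntegral_congr_fun measurableSet_Ioi fun t _ => ?_
    rw [mul_left_comm, ← integral_cube_mul_cexp, ← integral_const_mul]
    congr 1 with x
    rw [show -((1 + I * t) * x : ℂ) = ((-x : ℝ) : ℂ) + -(I * t * x) by push_cast; ring,
      Complex.exp_add, ← ofReal_exp]
    push_cast
    ring
  · refine setIntegral_congr_fun measurableSet_Ioi fun x _ => ?_
    have h := integral_rpow_mul_cexp_neg_mul (a := α + 1) (by linarith) (r := ε + I * x) (by simpa)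
    rw [ofReal_neg, mul_left_comm, ← h, ← integral_const_mul]
    congr 1 with t
    rw [show -((ε + I * x) * t : ℂ) = ((-(ε * t) : ℝ) : ℂ) + -(I * t * x) by push_cast; ring,
      Complex.exp_add, ← ofReal_exp]
    push_cast
    simp
    ring

lemma integral_rpow_mul_inv_one_add_I_mul_pow_four {α : ℝ} (hα : 0 < α) (hα2 : α ≤ 2) :
    6 * ∫ t in Set.Ioi (0 : ℝ), ((t ^ α : ℝ) : ℂ) * (((1 + I * t : ℂ)) ^ 4)⁻¹ =
      ((Real.Gamma (α + 1) * Real.Gamma (3 - α) : ℝ) : ℂ) *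
        cexp ((Real.pi * (-(α + 1)) / 2 : ℝ) * I) := by
  have hlim1 : Tendsto (fun ε : ℝ => ∫ t in Set.Ioi (0 : ℝ),
      ((t ^ α * Real.exp (-(ε * t)) : ℝ) : ℂ) * (((1 + I * t : ℂ)) ^ 4)⁻¹) (𝓝[>] 0)
      (𝓝 (∫ t in Set.Ioi (0 : ℝ), ((t ^ α : ℝ) : ℂ) * (((1 + I * t : ℂ)) ^ 4)⁻¹)) := by
    refine tendsto_integral_filter_of_dominated_convergence _ ?_ ?_
      (integrable_rpow_mul_norm_inv_pow_four hα.le hα2).integrableOn ?_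
    · exact Eventually.of_forall fun ε => Measurable.aestronglyMeasurable (by fun_prop)
    · filter_upwards [self_mem_nhdsWithin] with ε hε
      filter_upwards [ae_restrict_mem measurableSet_Ioi] with t ht
      have ht : 0 < t := ht
      have hε : 0 < ε := hε
      rw [norm_mul, Complex.norm_real, Real.norm_of_nonneg (by positivity), abs_of_pos ht]
      gcongr
      exact mul_le_of_le_one_right (by positivity) (Real.exp_le_one_iff.2 (by nlinarith))
    · filter_upwards with t
      have : Continuous fun ε : ℝ => ((t ^ α * Real.exp (-(ε * t)) : ℝ) : ℂ) *
          (((1 + I * t : ℂ)) ^ 4)⁻¹ := by fun_prop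
      exact (this.tendsto' 0 _ (by simp)).mono_left nhdsWithin_le_nhds
  have hGint := integrableOn_rpow_mul_exp_neg_mul (a := 3 - α) (b := 1) (by linarith) one_pos
  have hpow : ∀ x : ℝ, 0 < x → x ^ 3 * x ^ (-(α + 1)) = x ^ (3 - α - 1) := fun x hx => by
    rw [← Real.rpow_natCast, ← Real.rpow_add hx]
    congr 1
    push_cast
    ring
  have hlim2 : Tendsto (fun ε : ℝ => ∫ x in Set.Ioi (0 : ℝ),
      ((x ^ 3 * Real.exp (-x) : ℝ) : ℂ) * (ε + I * x) ^ ((-(α + 1) : ℝ) : ℂ)) (𝓝[>] 0)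
      (𝓝 (∫ x in Set.Ioi (0 : ℝ),
        ((x ^ 3 * Real.exp (-x) : ℝ) : ℂ) * (I * x) ^ ((-(α + 1) : ℝ) : ℂ))) := by
    refine tendsto_integral_filter_of_dominated_convergence _ ?_ ?_ hGint ?_
    · exact Eventually.of_forall fun ε => Measurable.aestronglyMeasurable (by fun_prop)
    · filter_upwards [self_mem_nhdsWithin] with ε hε
      filter_upwards [ae_restrict_mem measurableSet_Ioi] with x hx
      have hx : 0 < x := hx
      have hε : 0 < ε := hε
      have hxle : x ≤ ‖(ε + I * x : ℂ)‖ := by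
        simpa [abs_of_pos hx] using Complex.abs_im_le_norm (ε + I * x : ℂ)
      rw [norm_mul, Complex.norm_real, Real.norm_of_nonneg (by positivity),
        Complex.norm_cpow_real, ← hpow x hx, one_mul, mul_right_comm]
      gcongr ?_ * ?_ * _
      exact Real.rpow_le_rpow_of_nonpos hx hxle (by linarith)
    · filter_upwards [ae_restrict_mem measurableSet_Ioi] with x hx
      have hx : 0 < x := hx
      have h : ContinuousAt (fun ε : ℝ => ((x ^ 3 * Real.exp (-x) : ℝ) : ℂ) *
          ((ε : ℂ) + I * x) ^ ((-(α + 1) : ℝ) : ℂ)) 0 := by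
        refine continuousAt_const.mul (ContinuousAt.cpow (by fun_prop) continuousAt_const ?_)
        right
        simpa using hx.ne'
      have h' := h.tendsto
      simp only [ofReal_zero, zero_add] at h'
      exact h'.mono_left nhdsWithin_le_nhds
  have heq := tendsto_nhds_unique ((hlim1.const_mul 6).congr' (by
    filter_upwards [self_mem_nhdsWithin] with ε hε
    exact integral_rpow_mul_cexp_mul_inv_one_add_I_mul_pow_four hα hε))
    (hlim2.const_mul (Real.Gamma (α + 1) : ℂ))
  rw [heq, ofReal_mul, mul_assoc]
  congr 1
  have hG := Real.integral_rpow_mul_exp_neg_mul_Ioi (a := 3 - α) (r := 1) (by linarith) one_pos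
  simp only [div_one, Real.one_rpow, one_mul] at hG
  rw [← hG, ← integral_complex_ofReal, ← integral_mul_const]
  refine setIntegral_congr_fun measurableSet_Ioi fun x hx => ?_
  rw [I_mul_ofReal_cpow hx, ← hpow x hx]
  push_cast
  ring

lemma norm_cexp_sub_one_le_of_re_nonpos {z : ℂ} (hz : z.re ≤ 0) : ‖cexp z - 1‖ ≤ ‖z‖ := by
  have h := (convex_halfSpace_re_le 0).norm_image_sub_le_of_norm_deriv_le (𝕜 := ℂ)
    (f := cexp) (C := 1) (x := 0) (y := z)
    (fun w _ => Complex.differentiableAt_exp)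
    (fun w hw => by simpa [Complex.norm_exp] using hw) (by simp) hz
  simpa using h

/-- Integrating a characteristic function against the Fourier transform of the nonnegative function
`x ↦ (max x 0) ^ 3 * exp (-x)` gives a number with nonnegative real part. -/
lemma re_integral_inv_pow_four_mul_charFun_nonneg (μ : Measure ℝ) [IsProbabilityMeasure μ]
    (γ s : ℝ) :
    0 ≤ (∫ t : ℝ, (((1 + I * t : ℂ)) ^ 4)⁻¹ *
      (cexp (-(I * γ * (s * t : ℝ))) * charFun' μ (s * t))).re := by
  have hint : Integrable (Function.uncurry fun t x : ℝ =>
      (((1 + I * t : ℂ)) ^ 4)⁻¹ * cexp (I * t * (s * (x - γ) : ℝ))) (volume.prod μ) := by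
    have h : Integrable (fun p : ℝ × ℝ => (((1 + I * p.1 : ℂ)) ^ 4)⁻¹) (volume.prod μ) :=
      integrable_inv_one_add_I_mul_pow_four.comp_fst μ
    refine h.mul_bdd (c := 1) ?_ (Eventually.of_forall fun p => ?_)
    · exact Measurable.aestronglyMeasurable (by fun_prop)
    · simp [Complex.norm_exp]
  have h1 : ∫ t : ℝ, (((1 + I * t : ℂ)) ^ 4)⁻¹ *
      (cexp (-(I * γ * (s * t : ℝ))) * charFun' μ (s * t)) =
      ∫ t : ℝ, ∫ x, (((1 + I * t : ℂ)) ^ 4)⁻¹ * cexp (I * t * (s * (x - γ) : ℝ)) ∂μ := by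
    congr 1 with t
    rw [integral_const_mul, charFun', ← integral_const_mul]
    congr 2 with x
    rw [← Complex.exp_add]
    congr 1
    push_cast
    ring
  rw [h1, integral_integral_swap hint]
  simp only [mul_comm _ (cexp _), integral_cexp_mul_inv_one_add_I_mul_pow_four]
  rw [integral_complex_ofReal, ofReal_re]
  exact integral_nonneg fun x => by positivity

lemma re_integral_inv_pow_four_mul_exponent_nonneg {α c γ c' : ℝ} (hα : 0 < α) (hα2 : α ≤ 2)
    (hc : 0 < c) (μ : Measure ℝ) [IsProbabilityMeasure μ]
    (hφ : ∀ t : ℝ, charFun' μ t = cexp (I * γ * t -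
      ((c * |t| ^ α : ℝ) : ℂ) * (1 - I * c' * Real.sign t))) :
    0 ≤ ∫ t : ℝ, ((((1 + I * t : ℂ)) ^ 4)⁻¹ *
      -(((c * |t| ^ α : ℝ) : ℂ) * (1 - I * c' * Real.sign t))).re := by
  set ψ : ℝ → ℂ := fun t => -(((c * |t| ^ α : ℝ) : ℂ) * (1 - I * c' * Real.sign t)) with hψ
  have hsign : Measurable Real.sign := by
    unfold Real.sign
    exact Measurable.ite measurableSet_Iio measurable_const
      (Measurable.ite measurableSet_Ioi measurable_const measurable_const)
  have hψm : Measurable ψ := by fun_prop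
  have hψre : ∀ t, (ψ t).re ≤ 0 := fun t => by
    have : (ψ t).re = -(c * |t| ^ α) := by simp [hψ, -ofReal_mul]
    rw [this]
    exact neg_nonpos.2 (by positivity)
  have hψnorm : ∀ t, ‖ψ t‖ ≤ c * (1 + |c'|) * |t| ^ α := fun t => by
    have h1 : ‖(1 - I * c' * Real.sign t : ℂ)‖ ≤ 1 + |c'| := by
      refine (norm_sub_le _ _).trans ?_
      have : |Real.sign t| ≤ 1 := by
        rcases Real.sign_apply_eq t with h | h | h <;> simp [h]
      simp only [norm_one, norm_mul, norm_I, one_mul, Complex.norm_real, Real.norm_eq_abs]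
      gcongr
      exact mul_le_of_le_one_right (abs_nonneg _) this
    rw [hψ, norm_neg, norm_mul, Complex.norm_real, Real.norm_of_nonneg (by positivity)]
    calc c * |t| ^ α * _ ≤ c * |t| ^ α * (1 + |c'|) := by gcongr
      _ = _ := by ring
  have hψscale : ∀ u t : ℝ, 0 < u → ψ (u ^ α⁻¹ * t) = u * ψ t := fun u t hu => by
    have hs : 0 < u ^ α⁻¹ := by positivity
    have h1 : Real.sign (u ^ α⁻¹ * t) = Real.sign t := by
      rcases lt_trichotomy t 0 with h | h | h
      · rw [Real.sign_of_neg h, Real.sign_of_neg (mul_neg_of_pos_of_neg hs h)]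
      · simp [h]
      · rw [Real.sign_of_pos h, Real.sign_of_pos (mul_pos hs h)]
    simp only [hψ]
    rw [h1, abs_mul, abs_of_pos hs, Real.mul_rpow hs.le (abs_nonneg t), ← Real.rpow_mul hu.le,
      inv_mul_cancel₀ hα.ne', Real.rpow_one]
    push_cast
    ring
  have hK := integrable_inv_one_add_I_mul_pow_four
  have hK0 : ∫ t : ℝ, (((1 + I * t : ℂ)) ^ 4)⁻¹ = 0 := by
    simpa using integral_cexp_mul_inv_one_add_I_mul_pow_four 0
  have hpos : ∀ u : ℝ, 0 < u →
      0 ≤ (∫ t : ℝ, (((1 + I * t : ℂ)) ^ 4)⁻¹ * ((cexp (u * ψ t) - 1) / u)).re := by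
    intro u hu
    have h := re_integral_inv_pow_four_mul_charFun_nonneg μ γ (u ^ α⁻¹)
    have h1 : ∀ t : ℝ, cexp (-(I * γ * (u ^ α⁻¹ * t : ℝ))) * charFun' μ (u ^ α⁻¹ * t) =
        cexp (u * ψ t) := fun t => by
      rw [hφ, ← Complex.exp_add, ← hψscale u t hu]
      congr 1
      simp only [hψ]
      ring
    simp only [h1] at h
    have hbdd : Integrable fun t : ℝ => (((1 + I * t : ℂ)) ^ 4)⁻¹ * cexp (u * ψ t) := by
      refine hK.mul_bdd (c := 1) (Measurable.aestronglyMeasurable (by fun_prop))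
        (Eventually.of_forall fun t => ?_)
      rw [Complex.norm_exp, Real.exp_le_one_iff, re_ofReal_mul]
      exact mul_nonpos_of_nonneg_of_nonpos hu.le (hψre t)
    have h2 : ∫ t : ℝ, (((1 + I * t : ℂ)) ^ 4)⁻¹ * ((cexp (u * ψ t) - 1) / u) =
        ((u⁻¹ : ℝ) : ℂ) * ∫ t : ℝ, (((1 + I * t : ℂ)) ^ 4)⁻¹ * cexp (u * ψ t) := by
      have h3 : ∫ t : ℝ, ((((1 + I * t : ℂ)) ^ 4)⁻¹ * cexp (u * ψ t) - (((1 + I * t : ℂ)) ^ 4)⁻¹) =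
          ∫ t : ℝ, (((1 + I * t : ℂ)) ^ 4)⁻¹ * cexp (u * ψ t) := by
        rw [integral_sub hbdd hK, hK0, sub_zero]
      rw [← h3, ← integral_const_mul]
      congr 1 with t
      push_cast
      ring
    rw [h2, re_ofReal_mul]
    positivity
  have hlim : Tendsto (fun u : ℝ => ∫ t : ℝ, (((1 + I * t : ℂ)) ^ 4)⁻¹ * ((cexp (u * ψ t) - 1) / u))
      (𝓝[>] 0) (𝓝 (∫ t : ℝ, (((1 + I * t : ℂ)) ^ 4)⁻¹ * ψ t)) := by
    refine tendsto_integral_filter_of_dominated_convergence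
      (fun t => c * (1 + |c'|) * (|t| ^ α * ‖(((1 + I * t : ℂ)) ^ 4)⁻¹‖)) ?_ ?_
      ((integrable_rpow_mul_norm_inv_pow_four hα.le hα2).const_mul _) ?_
    · exact Eventually.of_forall fun u => Measurable.aestronglyMeasurable (by fun_prop)
    · filter_upwards [self_mem_nhdsWithin] with u hu
      have hu : 0 < u := hu
      refine Eventually.of_forall fun t => ?_
      have h1 : ‖(cexp (u * ψ t) - 1) / u‖ ≤ ‖ψ t‖ := by
        rw [norm_div, Complex.norm_real, Real.norm_of_nonneg hu.le, div_le_iff₀ hu]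
        refine (norm_cexp_sub_one_le_of_re_nonpos ?_).trans_eq ?_
        · rw [re_ofReal_mul]
          exact mul_nonpos_of_nonneg_of_nonpos hu.le (hψre t)
        · rw [norm_mul, Complex.norm_real, Real.norm_of_nonneg hu.le, mul_comm]
      rw [norm_mul, ← mul_assoc, mul_comm]
      gcongr
      exact h1.trans (hψnorm t)
    · refine Eventually.of_forall fun t => Tendsto.const_mul _ ?_
      have hd : HasDerivAt (fun u : ℝ => cexp (u * ψ t)) (ψ t) 0 := by
        simpa using ((hasDerivAt_id (0 : ℝ)).ofReal_comp.mul_const (ψ t)).cexp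
      refine (hd.tendsto_slope.mono_left
        (nhdsWithin_mono 0 fun x hx => ne_of_gt hx)).congr fun u => ?_
      simp [slope_def_module, div_eq_inv_mul]
  have hKψ : Integrable fun t : ℝ => (((1 + I * t : ℂ)) ^ 4)⁻¹ * ψ t := by
    refine ((integrable_rpow_mul_norm_inv_pow_four hα.le hα2).const_mul (c * (1 + |c'|))).mono'
      (Measurable.aestronglyMeasurable (by fun_prop)) (Eventually.of_forall fun t => ?_)
    rw [norm_mul, ← mul_assoc, mul_comm]
    gcongr
    exact hψnorm t
  refine (ge_of_tendsto ((continuous_re.tendsto _).comp hlim) ?_).trans_eq (integral_re hKψ).symm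
  filter_upwards [self_mem_nhdsWithin] with u hu
  exact hpos u hu

lemma sin_add_mul_cos_nonneg_of_charFun {α c γ c' : ℝ} (hα : 0 < α) (hα2 : α ≤ 2)
    (hc : 0 < c) (μ : Measure ℝ) [IsProbabilityMeasure μ]
    (hφ : ∀ t : ℝ, charFun' μ t = cexp (I * γ * t -
      ((c * |t| ^ α : ℝ) : ℂ) * (1 - I * c' * Real.sign t))) :
    0 ≤ Real.sin (Real.pi * α / 2) + c' * Real.cos (Real.pi * α / 2) := by
  have h := re_integral_inv_pow_four_mul_exponent_nonneg hα hα2 hc μ hφ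
  set g : ℝ → ℂ := fun t => (-c * (1 - I * c')) * (((t ^ α : ℝ) : ℂ) * (((1 + I * t : ℂ)) ^ 4)⁻¹)
    with hg
  have hgint : IntegrableOn g (Set.Ioi 0) := by
    refine Integrable.const_mul ?_ _
    refine (integrable_rpow_mul_norm_inv_pow_four hα.le hα2).integrableOn.mono'
      (Measurable.aestronglyMeasurable (by fun_prop)) ?_
    filter_upwards [ae_restrict_mem measurableSet_Ioi] with t ht
    have ht : 0 < t := ht
    rw [norm_mul, Complex.norm_real, Real.norm_of_nonneg (by positivity), abs_of_pos ht]
  have heven : ∀ t : ℝ, ((((1 + I * t : ℂ)) ^ 4)⁻¹ *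
      -(((c * |t| ^ α : ℝ) : ℂ) * (1 - I * c' * Real.sign t))).re = (g |t|).re := by
    intro t
    rcases lt_trichotomy t 0 with ht | ht | ht
    · rw [← Complex.conj_re]
      congr 1
      simp only [hg, abs_of_neg ht, Real.sign_of_neg ht, map_mul, map_neg, map_sub, map_inv₀,
        map_pow, map_add, map_one, conj_I, conj_ofReal]
      push_cast
      ring
    · simp [hg, ht, Real.zero_rpow hα.ne']
    · congr 1
      simp only [hg, abs_of_pos ht, Real.sign_of_pos ht]
      push_cast
      ring
  have hval := integral_rpow_mul_inv_one_add_I_mul_pow_four hα hα2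
  simp only [heven] at h
  rw [integral_comp_abs (f := fun t => (g t).re),
    show ∫ t in Set.Ioi (0 : ℝ), (g t).re = (∫ t in Set.Ioi (0 : ℝ), g t).re from integral_re hgint,
    integral_const_mul, show ∀ z w : ℂ, z * w = z * (((1 / 6 : ℝ) : ℂ) * (6 * w)) from
      fun z w => by push_cast; ring, hval] at h
  have hang : Real.pi * (-(α + 1)) / 2 = -(Real.pi * α / 2 + Real.pi / 2) := by ring
  have hcexp : cexp ((Real.pi * (-(α + 1)) / 2 : ℝ) * I) =
      ((-Real.sin (Real.pi * α / 2) : ℝ) : ℂ) - ((Real.cos (Real.pi * α / 2) : ℝ) : ℂ) * I := by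
    rw [hang, Complex.exp_mul_I, ← ofReal_cos, ← ofReal_sin, Real.cos_neg, Real.sin_neg,
      Real.cos_add_pi_div_two, Real.sin_add_pi_div_two]
    push_cast
    ring
  have hB : 0 < Real.Gamma (α + 1) * Real.Gamma (3 - α) :=
    mul_pos (Real.Gamma_pos_of_pos (by linarith)) (Real.Gamma_pos_of_pos (by linarith))
  rw [hcexp] at h
  set B := Real.Gamma (α + 1) * Real.Gamma (3 - α)
  have hre : ∀ S C : ℝ, ((-c * (1 - I * c') : ℂ) *
      (((1 / 6 : ℝ) : ℂ) * ((B : ℂ) * (((-S : ℝ) : ℂ) - (C : ℂ) * I)))).re =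
      c * (1 / 6) * B * (S + c' * C) := fun S C => by
    simp
    ring
  rw [hre] at h
  have hpos : 0 < 2 * (c * (1 / 6) * B) := by positivity
  rw [← mul_assoc] at h
  exact nonneg_of_mul_nonneg_right h hpos

lemma charFun'_map_neg (μ : Measure ℝ) (t : ℝ) :
    charFun' (μ.map fun x => -x) t = charFun' μ (-t) := by
  rw [charFun', charFun', integral_map (by fun_prop)
    (Measurable.aestronglyMeasurable (by fun_prop))]
  simp

theorem stmt16 (α c γ c' : ℝ) (hα : 0 < α) (hα2 : α ≤ 2) (hα1 : α ≠ 1) (hc : 0 < c)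
    (μ : Measure ℝ) [IsProbabilityMeasure μ]
    (hφ : ∀ t : ℝ, charFun' μ t =
      Complex.exp (Complex.I * γ * t -
        ((c * |t| ^ α : ℝ) : ℂ) * (1 - Complex.I * c' * Real.sign t))) :
    (α < 2 → |c'| ≤ |Real.tan (Real.pi * α / 2)|) ∧ (α = 2 → c' = 0) := by
  have h1 := sin_add_mul_cos_nonneg_of_charFun hα hα2 hc μ hφ
  have : IsProbabilityMeasure (μ.map fun x => -x) :=
    Measure.isProbabilityMeasure_map (by fun_prop)
  have h2 := sin_add_mul_cos_nonneg_of_charFun (γ := -γ) (c' := -c') hα hα2 hc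
    (μ.map fun x => -x) (fun t => by
      rw [charFun'_map_neg, hφ, abs_neg, Real.sign_neg]
      push_cast
      congr 1
      ring)
  refine ⟨fun hlt => ?_, fun h => ?_⟩
  · have hpi := Real.pi_pos
    have hcos : Real.cos (Real.pi * α / 2) ≠ 0 := by
      rcases lt_or_gt_of_ne hα1 with h | h
      · exact (Real.cos_pos_of_mem_Ioo ⟨by nlinarith, by nlinarith⟩).ne'
      · exact (Real.cos_neg_of_pi_div_two_lt_of_lt (by nlinarith) (by nlinarith)).ne
    rw [Real.tan_eq_sin_div_cos, abs_div, le_div_iff₀ (abs_pos.2 hcos), ← abs_mul]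
    exact (abs_le.2 ⟨by linarith, by linarith⟩ : _ ≤ Real.sin (Real.pi * α / 2)).trans
      (le_abs_self _)
  · subst h
    rw [mul_div_cancel_right₀ _ (two_ne_zero), Real.sin_pi, Real.cos_pi] at h1 h2
    linarith
end

section
/- Let c > 0, y ∈ ℝ, c' ∈ ℝ, and suppose the function φ defined by φ(t) = exp( i y t − c (|t| + i c' t log|t|) ) for t ≠ 0 and φ(0) = 1 is the characteristic function of some probability measure on ℝ. Then |c'| ≤ 2/π, i.e. c' = 2β/π for some β ∈ [−1, 1]. -/
open MeasureTheory Complex Filter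

open scoped Topology

/-- The second difference of `t ↦ t * log t` on the naturals, centred at `n + 1`. -/
noncomputable def secondDiffMulLog (n : ℕ) : ℝ :=
  (n + 2 : ℝ) * Real.log (n + 2) - 2 * ((n + 1 : ℝ) * Real.log (n + 1)) + n * Real.log n

lemma abs_entropy_sub_sq_le {u : ℝ} (hu : 0 < u) (hu' : u ≤ 1 / 2) :
    |(1 + u) * Real.log (1 + u) + (1 - u) * Real.log (1 - u) - u ^ 2| ≤ 4 * u ^ 3 := by
  have key : ∀ v : ℝ, |v| = u → |v + v ^ 2 / 2 + Real.log (1 - v)| ≤ 2 * u ^ 3 := by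
    intro v hv
    have h := Real.abs_log_sub_add_sum_range_le (x := v) (by rw [hv]; linarith) 2
    simp only [Finset.sum_range_succ, Finset.sum_range_zero, hv] at h
    norm_num at h
    refine h.trans ?_
    rw [div_le_iff₀ (by linarith)]
    nlinarith [pow_pos hu 3]
  have h1 := key u (abs_of_pos hu)
  have h2 := key (-u) (by rw [abs_neg, abs_of_pos hu])
  rw [sub_neg_eq_add] at h2
  rw [abs_le] at h1 h2 ⊢
  have hp : 0 ≤ 1 + u := by linarith
  have hm : 0 ≤ 1 - u := by linarith
  constructor
  · nlinarith [mul_le_mul_of_nonneg_left h1.1 hm, mul_le_mul_of_nonneg_left h2.1 hp]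
  · nlinarith [mul_le_mul_of_nonneg_left h1.2 hm, mul_le_mul_of_nonneg_left h2.2 hp]

lemma abs_secondDiffMulLog_sub_inv_le (n : ℕ) :
    |secondDiffMulLog n - 1 / (n + 1)| ≤ 4 * (1 / (n + 1 : ℝ) ^ 2) := by
  rcases Nat.eq_zero_or_pos n with rfl | hn
  · have h1 := Real.log_two_gt_d9
    have h2 := Real.log_two_lt_d9
    simp only [secondDiffMulLog]
    norm_num
    rw [abs_le]
    constructor <;> linarith
  · have hn1 : (1 : ℝ) ≤ n := by exact_mod_cast hn
    have hN : (0 : ℝ) < n + 1 := by linarith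
    have h := abs_entropy_sub_sq_le (u := 1 / (n + 1 : ℝ)) (by positivity)
      (by rw [div_le_div_iff₀ hN (by norm_num)]; linarith)
    have e1 : 1 + 1 / (n + 1 : ℝ) = (n + 2) / (n + 1) := by field_simp; ring
    have e2 : 1 - 1 / (n + 1 : ℝ) = n / (n + 1) := by field_simp; ring
    rw [e1, e2, Real.log_div (by linarith) hN.ne', Real.log_div (by linarith) hN.ne'] at h
    have e3 : secondDiffMulLog n - 1 / (n + 1) = (n + 1) *
        ((n + 2) / (n + 1) * (Real.log (n + 2) - Real.log (n + 1)) +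
          n / (n + 1) * (Real.log n - Real.log (n + 1)) - (1 / (n + 1 : ℝ)) ^ 2) := by
      unfold secondDiffMulLog
      field_simp
      ring
    rw [e3, abs_mul, abs_of_pos hN]
    refine (mul_le_mul_of_nonneg_left h hN.le).trans (le_of_eq ?_)
    field_simp

lemma summable_four_mul_one_div_succ_sq :
    Summable fun n : ℕ => 4 * (1 / (n + 1 : ℝ) ^ 2) := by
  have h := (summable_nat_add_iff 1).2 (Real.summable_one_div_nat_pow.2 one_lt_two)
  simpa using h.mul_left 4

lemma norm_tangential_path_lt_one {s : ℝ} (hs : s ∈ Set.Ioo (0 : ℝ) 1) :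
    ‖1 - (s : ℂ) ^ 2 + I * s‖ < 1 := by
  have h : ‖1 - (s : ℂ) ^ 2 + I * s‖ ^ 2 < 1 := by
    have hre : (1 - (s : ℂ) ^ 2 + I * s).re = 1 - s ^ 2 := by simp [← Complex.ofReal_pow]
    have him : (1 - (s : ℂ) ^ 2 + I * s).im = s := by simp [← Complex.ofReal_pow]
    rw [← Complex.normSq_eq_norm_sq, Complex.normSq_apply, hre, him]
    have h2 : s ^ 2 < 1 := by nlinarith [hs.1, hs.2]
    nlinarith [mul_pos (pow_pos hs.1 2) (sub_pos.2 h2)]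
  nlinarith [norm_nonneg (1 - (s : ℂ) ^ 2 + I * s)]

/-- Along the tangential path `1 - s ^ 2 + i s` to `1`, the imaginary part of the generating
function of `secondDiffMulLog` tends to `π / 2`. -/
lemma tendsto_im_tsum_secondDiffMulLog :
    Tendsto (fun s : ℝ => (∑' n : ℕ, (secondDiffMulLog n : ℂ) *
      (1 - (s : ℂ) ^ 2 + I * s) ^ (n + 1)).im) (𝓝[>] 0) (𝓝 (Real.pi / 2)) := by
  set w : ℝ → ℂ := fun s => 1 - (s : ℂ) ^ 2 + I * s with hw
  have hIoo : ∀ᶠ s : ℝ in 𝓝[>] 0, s ∈ Set.Ioo (0 : ℝ) 1 :=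
    Ioo_mem_nhdsGT one_pos
  have hnorm : ∀ s ∈ Set.Ioo (0 : ℝ) 1, ‖w s‖ < 1 := fun s hs => norm_tangential_path_lt_one hs
  have hwcont : Continuous w := by fun_prop
  have hrem : Tendsto (fun s => ∑' n : ℕ, ((secondDiffMulLog n - 1 / (n + 1) : ℝ) : ℂ) *
      w s ^ (n + 1)) (𝓝[>] 0) (𝓝 (∑' n : ℕ, ((secondDiffMulLog n - 1 / (n + 1) : ℝ) : ℂ))) := by
    refine tendsto_tsum_of_dominated_convergence summable_four_mul_one_div_succ_sq ?_ ?_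
    · intro n
      have : Tendsto (fun s => ((secondDiffMulLog n - 1 / (n + 1) : ℝ) : ℂ) * w s ^ (n + 1))
          (𝓝 0) (𝓝 (((secondDiffMulLog n - 1 / (n + 1) : ℝ) : ℂ) * w 0 ^ (n + 1))) :=
        Continuous.tendsto (by fun_prop) 0
      have h0 : w 0 = 1 := by simp [hw]
      rw [h0, one_pow, mul_one] at this
      exact this.mono_left nhdsWithin_le_nhds
    · filter_upwards [hIoo] with s hs n
      rw [norm_mul, norm_pow, Complex.norm_real, Real.norm_eq_abs]
      exact (mul_le_of_le_one_right (abs_nonneg _)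
        (pow_le_one₀ (norm_nonneg _) (hnorm s hs).le)).trans (abs_secondDiffMulLog_sub_inv_le n)
  have hrem' := (Complex.continuous_im.tendsto _).comp hrem
  rw [← Complex.ofReal_tsum, Complex.ofReal_im] at hrem'
  have harg : Tendsto (fun s : ℝ => -Complex.arg ((s : ℂ) - I)) (𝓝[>] 0) (𝓝 (Real.pi / 2)) := by
    have h1 : Tendsto (fun s : ℝ => (s : ℂ) - I) (𝓝 0) (𝓝 (-I)) := by
      have : Continuous fun s : ℝ => (s : ℂ) - I := by fun_prop
      simpa using this.tendsto 0
    have h2 := ((Complex.continuousAt_arg (x := -I) (by simp [Complex.slitPlane])).tendsto.comp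
      h1).neg
    rw [Complex.arg_neg_I, neg_neg] at h2
    exact h2.mono_left nhdsWithin_le_nhds
  have hsum := harg.add hrem'
  rw [add_zero] at hsum
  refine hsum.congr' ?_
  filter_upwards [hIoo] with s hs
  have hlog := (hasSum_nat_add_iff' 1).2 (Complex.hasSum_taylorSeries_neg_log (hnorm s hs))
  simp only [Finset.sum_range_one, pow_zero, Nat.cast_zero, div_zero, sub_zero] at hlog
  have hremS : Summable fun n : ℕ => ((secondDiffMulLog n - 1 / (n + 1) : ℝ) : ℂ) *
      w s ^ (n + 1) := by
    refine Summable.of_norm_bounded summable_four_mul_one_div_succ_sq fun n => ?_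
    rw [norm_mul, norm_pow, Complex.norm_real, Real.norm_eq_abs]
    exact (mul_le_of_le_one_right (abs_nonneg _)
      (pow_le_one₀ (norm_nonneg _) (hnorm s hs).le)).trans (abs_secondDiffMulLog_sub_inv_le n)
  have htot := hlog.add hremS.hasSum
  have heq : (fun n : ℕ => w s ^ (n + 1) / ((n + 1 : ℕ) : ℂ) +
      ((secondDiffMulLog n - 1 / (n + 1) : ℝ) : ℂ) * w s ^ (n + 1)) =
      fun n : ℕ => (secondDiffMulLog n : ℂ) * w s ^ (n + 1) := by
    funext n
    push_cast
    ring
  rw [heq] at htot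
  rw [htot.tsum_eq, Complex.add_im, Complex.neg_im, Complex.log_im]
  have hfac : 1 - w s = (s : ℂ) * ((s : ℂ) - I) := by simp only [hw]; ring
  rw [hfac, Complex.arg_real_mul _ hs.1]
  rfl

lemma one_add_two_mul_tsum_pow_succ_re_nonneg {z : ℂ} (hz : ‖z‖ < 1) :
    0 ≤ 1 + 2 * (∑' n : ℕ, z ^ (n + 1)).re := by
  have h1 : 1 - z ≠ 0 := by
    intro h
    rw [← sub_eq_zero.1 h] at hz
    simp at hz
  have hs : ∑' n : ℕ, z ^ (n + 1) = z / (1 - z) := by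
    simp_rw [pow_succ]
    rw [tsum_mul_right, tsum_geometric_of_norm_lt_one hz, div_eq_inv_mul]
  have hn : 0 < Complex.normSq (1 - z) := Complex.normSq_pos.2 h1
  have hz2 : z.re * z.re + z.im * z.im < 1 := by
    rw [← Complex.normSq_apply, Complex.normSq_eq_norm_sq]
    nlinarith [norm_nonneg z]
  rw [hs, Complex.div_re, ← add_div, mul_div_assoc', ← div_self hn.ne', ← add_div]
  refine div_nonneg ?_ hn.le
  rw [Complex.normSq_apply]
  simp only [Complex.sub_re, Complex.sub_im, Complex.one_re, Complex.one_im]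
  nlinarith

/-- Testing the positive measure `(1 - cos (ε x)) dμ` against the Poisson kernel. -/
lemma integral_one_sub_cos_poisson_nonneg (μ : Measure ℝ) [IsFiniteMeasure μ] (ε : ℝ) {w : ℂ}
    (hw : ‖w‖ < 1) :
    0 ≤ (∫ x, (1 - Real.cos (ε * x)) ∂μ) + 2 * (∑' n : ℕ, w ^ (n + 1) *
      ∫ x, ((1 - Real.cos (ε * x) : ℝ) : ℂ) * cexp (I * ε * x) ^ (n + 1) ∂μ).re := by
  have hu : ∀ x : ℝ, ‖cexp (I * ε * x)‖ = 1 := by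
    intro x
    have : I * ε * x = ((ε * x : ℝ) : ℂ) * I := by push_cast; ring
    rw [this, Complex.norm_exp_ofReal_mul_I]
  have hcos : ∀ x : ℝ, |1 - Real.cos (ε * x)| ≤ 2 := fun x => by
    rw [abs_le]
    constructor <;> linarith [Real.neg_one_le_cos (ε * x), Real.cos_le_one (ε * x)]
  set F : ℕ → ℝ → ℂ := fun n x =>
    w ^ (n + 1) * (((1 - Real.cos (ε * x) : ℝ) : ℂ) * cexp (I * ε * x) ^ (n + 1)) with hF
  have hFn : ∀ n x, ‖F n x‖ ≤ 2 * ‖w‖ ^ (n + 1) := by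
    intro n x
    simp only [hF, norm_mul, norm_pow, hu, one_pow, mul_one, Complex.norm_real, Real.norm_eq_abs]
    rw [mul_comm]
    exact mul_le_mul_of_nonneg_right (hcos x) (by positivity)
  have hFi : ∀ n, Integrable (F n) μ := fun n =>
    Integrable.of_bound (Continuous.aestronglyMeasurable (by fun_prop)) _
      (Eventually.of_forall (hFn n))
  have hgeo : Summable fun n : ℕ => 2 * ‖w‖ ^ (n + 1) :=
    ((summable_nat_add_iff 1).2 (summable_geometric_of_lt_one (norm_nonneg w) hw)).mul_left 2
  have hsn : Summable fun n => ∫ x, ‖F n x‖ ∂μ := by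
    refine Summable.of_nonneg_of_le (fun n => integral_nonneg fun x => norm_nonneg _)
      (fun n => ?_) (hgeo.mul_right (μ.real Set.univ))
    have := integral_mono (hFi n).norm (integrable_const (2 * ‖w‖ ^ (n + 1))) (hFn n)
    simpa [mul_comm] using this
  have hswap := integral_tsum_of_summable_integral_norm hFi hsn
  have hts : ∑' n : ℕ, w ^ (n + 1) *
      ∫ x, ((1 - Real.cos (ε * x) : ℝ) : ℂ) * cexp (I * ε * x) ^ (n + 1) ∂μ =
      ∫ x, ∑' n, F n x ∂μ := by
    rw [← hswap]
    refine tsum_congr fun n => ?_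
    rw [← integral_const_mul]
  have hti : Integrable (fun x => ∑' n, F n x) μ :=
    Integrable.of_bound (C := ∑' n : ℕ, 2 * ‖w‖ ^ (n + 1))
      (continuous_tsum (fun n => by fun_prop) hgeo hFn).aestronglyMeasurable
      (Eventually.of_forall fun x => tsum_of_norm_bounded hgeo.hasSum (hFn · x))
  have hci : Integrable (fun x => 1 - Real.cos (ε * x)) μ :=
    Integrable.of_bound (Continuous.aestronglyMeasurable (by fun_prop)) 2
      (Eventually.of_forall hcos)
  have hti' : Integrable (fun x => (∑' n, F n x).re) μ := hti.re
  have hre : (∫ x, ∑' n, F n x ∂μ).re = ∫ x, (∑' n, F n x).re ∂μ :=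
    (integral_re hti).symm
  rw [hts, hre, ← integral_const_mul, ← integral_add hci (hti'.const_mul 2)]
  refine integral_nonneg fun x => ?_
  have hFx : ∑' n, F n x = ((1 - Real.cos (ε * x) : ℝ) : ℂ) *
      ∑' n : ℕ, (w * cexp (I * ε * x)) ^ (n + 1) := by
    rw [← tsum_mul_left]
    refine tsum_congr fun n => ?_
    simp only [hF, mul_pow]
    ring
  have hpos := one_add_two_mul_tsum_pow_succ_re_nonneg (z := w * cexp (I * ε * x))
    (by rwa [norm_mul, hu, mul_one])
  simp only [Pi.zero_apply]
  rw [hFx, Complex.re_ofReal_mul]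
  nlinarith [mul_nonneg (sub_nonneg.2 (Real.cos_le_one (ε * x))) hpos]

lemma integrable_exp_I_mul_pow (μ : Measure ℝ) [IsFiniteMeasure μ] (ε : ℝ) (k : ℕ) :
    Integrable (fun x : ℝ => cexp (I * ε * x) ^ k) μ := by
  refine Integrable.of_bound (C := 1) (Continuous.aestronglyMeasurable (by fun_prop))
    (Eventually.of_forall fun x => ?_)
  have : I * ε * x = ((ε * x : ℝ) : ℂ) * I := by push_cast; ring
  rw [norm_pow, this, Complex.norm_exp_ofReal_mul_I, one_pow]

lemma charFun'_nat_mul (μ : Measure ℝ) (ε : ℝ) (k : ℕ) :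
    charFun' μ (k * ε) = ∫ x : ℝ, cexp (I * ε * x) ^ k ∂μ := by
  unfold charFun'
  congr 1
  funext x
  rw [← Complex.exp_nat_mul]
  push_cast
  ring_nf

lemma integral_one_sub_cos_mul_exp_pow (μ : Measure ℝ) [IsFiniteMeasure μ] (ε : ℝ) (n : ℕ) :
    ∫ x, ((1 - Real.cos (ε * x) : ℝ) : ℂ) * cexp (I * ε * x) ^ (n + 1) ∂μ =
      charFun' μ ((n + 1 : ℕ) * ε) -
        (charFun' μ ((n + 2 : ℕ) * ε) + charFun' μ (n * ε)) / 2 := by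
  have hadd : Integrable (fun x : ℝ =>
      (cexp (I * ε * x) ^ (n + 2) + cexp (I * ε * x) ^ n) / 2) μ :=
    ((integrable_exp_I_mul_pow μ ε _).add (integrable_exp_I_mul_pow μ ε _)).div_const 2
  rw [charFun'_nat_mul, charFun'_nat_mul, charFun'_nat_mul,
    ← integral_add (integrable_exp_I_mul_pow μ ε _) (integrable_exp_I_mul_pow μ ε _),
    ← integral_div, ← integral_sub (integrable_exp_I_mul_pow μ ε _) hadd]
  congr 1
  funext x
  have h1 : ((Real.cos (ε * x) : ℝ) : ℂ) = (cexp (I * ε * x) + (cexp (I * ε * x))⁻¹) / 2 := by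
    rw [Complex.ofReal_cos, Complex.cos, ← Complex.exp_neg]
    push_cast
    ring_nf
  have h2 := Complex.exp_ne_zero (I * ε * x)
  push_cast [-Complex.ofReal_cos]
  rw [h1]
  field_simp
  ring

lemma integral_one_sub_cos (μ : Measure ℝ) [IsProbabilityMeasure μ] (ε : ℝ) :
    ∫ x, (1 - Real.cos (ε * x)) ∂μ = (1 - charFun' μ ε).re := by
  have h := charFun'_nat_mul μ ε 1
  have hi := integrable_exp_I_mul_pow μ ε 1
  simp only [Nat.cast_one, one_mul, pow_one] at h hi
  have h1 : (1 : ℂ) - charFun' μ ε = ∫ x : ℝ, (1 - cexp (I * ε * x)) ∂μ := by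
    rw [integral_sub (integrable_const _) hi, h]
    simp
  rw [h1]
  refine Eq.trans ?_ (integral_re ((integrable_const (1 : ℂ)).sub hi))
  congr 1
  funext x
  have : I * ε * x = ((ε * x : ℝ) : ℂ) * I := by push_cast; ring
  simp only [Pi.sub_apply, this, RCLike.re_to_complex, Complex.sub_re, Complex.one_re,
    Complex.exp_ofReal_mul_I_re]

lemma tendsto_exp_remainder_div (a b : ℂ) :
    Tendsto (fun ε : ℝ => (cexp (ε * (a + b * Real.log ε)) - 1 - ε * (a + b * Real.log ε)) / ε)
      (𝓝[>] 0) (𝓝 0) := by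
  have hsq : Tendsto (fun ε : ℝ => ((ε ^ (1 / 2 : ℝ) : ℝ) : ℂ)) (𝓝[>] 0) (𝓝 0) := by
    have h : Tendsto (fun ε : ℝ => ε ^ (1 / 2 : ℝ)) (𝓝 0) (𝓝 (0 ^ (1 / 2 : ℝ))) :=
      (Real.continuousAt_rpow_const 0 (1 / 2) (Or.inr (by norm_num))).tendsto
    rw [Real.zero_rpow (by norm_num)] at h
    exact_mod_cast (Complex.continuous_ofReal.tendsto 0).comp (h.mono_left nhdsWithin_le_nhds)
  have hlog : Tendsto (fun ε : ℝ => ((Real.log ε * ε ^ (1 / 2 : ℝ) : ℝ) : ℂ)) (𝓝[>] 0) (𝓝 0) := by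
    exact_mod_cast (Complex.continuous_ofReal.tendsto 0).comp
      (tendsto_log_mul_rpow_nhdsGT_zero (r := 1 / 2) (by norm_num))
  have hg : Tendsto (fun ε : ℝ => ((ε ^ (1 / 2 : ℝ) : ℝ) : ℂ) * (a + b * Real.log ε))
      (𝓝[>] 0) (𝓝 0) := by
    have := (hsq.const_mul a).add (hlog.const_mul b)
    rw [mul_zero, mul_zero, add_zero] at this
    refine this.congr fun ε => ?_
    push_cast
    ring
  have hz : Tendsto (fun ε : ℝ => (ε : ℂ) * (a + b * Real.log ε)) (𝓝[>] 0) (𝓝 0) := by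
    have := hsq.mul hg
    rw [mul_zero] at this
    refine this.congr' ?_
    filter_upwards [self_mem_nhdsWithin] with ε (hε : 0 < ε)
    rw [← mul_assoc, ← Complex.ofReal_mul, ← Real.rpow_add hε]
    norm_num
  have hbound := (hg.norm.pow 2)
  rw [norm_zero, zero_pow two_ne_zero] at hbound
  refine squeeze_zero_norm' ?_ hbound
  have hsmall := hz.norm.eventually (gt_mem_nhds (by simp : ‖(0 : ℂ)‖ < 1))
  filter_upwards [self_mem_nhdsWithin, hsmall] with ε (hε : 0 < ε) hlt
  rw [norm_div, Complex.norm_real, Real.norm_of_nonneg hε.le, div_le_iff₀ hε]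
  refine (Complex.norm_exp_sub_one_sub_id_le hlt.le).trans (le_of_eq ?_)
  rw [norm_mul, norm_mul, Complex.norm_real, Complex.norm_real, Real.norm_of_nonneg hε.le,
    Real.norm_of_nonneg (by positivity), mul_pow, mul_pow, ← Real.rpow_natCast (ε ^ (1 / 2 : ℝ)),
    ← Real.rpow_mul hε.le]
  norm_num
  ring

/-- If `charFun' μ` has the given form, the renormalised measures `(1 - cos (ε x)) / ε dμ` have
convergent Fourier coefficients, and positivity passes to the limit. -/
lemma mul_im_tsum_secondDiffMulLog_le_one (c y c' : ℝ) (hc : 0 < c)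
    (μ : Measure ℝ) [IsProbabilityMeasure μ]
    (hφ : ∀ t : ℝ, 0 ≤ t → charFun' μ t =
      cexp (I * y * t - c * (t + I * c' * t * Real.log t)))
    {w : ℂ} (hw : ‖w‖ < 1) :
    c' * (∑' n : ℕ, (secondDiffMulLog n : ℂ) * w ^ (n + 1)).im ≤ 1 := by
  set R : ℕ → ℝ → ℂ := fun k ε => (charFun' μ (k * ε) - 1 - ε * ((I * y * k - c * k
    - I * c * c' * k * Real.log k) + (-(I * c * c' * k)) * Real.log ε)) / ε with hR
  have hR0 : ∀ k, Tendsto (R k) (𝓝[>] 0) (𝓝 0) := by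
    intro k
    refine (tendsto_exp_remainder_div (I * y * k - c * k - I * c * c' * k * Real.log k)
      (-(I * c * c' * k))).congr' ?_
    filter_upwards [self_mem_nhdsWithin] with ε (hε : 0 < ε)
    simp only [hR]
    rw [hφ _ (by positivity)]
    congr 4
    rcases Nat.eq_zero_or_pos k with rfl | hk
    · simp
    · rw [Real.log_mul (by positivity) hε.ne']
      push_cast
      ring
  set A : ℝ → ℝ := fun ε => (∫ x, (1 - Real.cos (ε * x)) ∂μ) / ε with hA
  set B : ℕ → ℝ → ℂ := fun n ε =>
    (∫ x, ((1 - Real.cos (ε * x) : ℝ) : ℂ) * cexp (I * ε * x) ^ (n + 1) ∂μ) / ε with hB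
  have hAlim : Tendsto A (𝓝[>] 0) (𝓝 c) := by
    have h := ((Complex.continuous_re.tendsto _).comp (hR0 1)).const_sub c
    rw [Complex.zero_re, sub_zero] at h
    refine h.congr' ?_
    filter_upwards [self_mem_nhdsWithin] with ε (hε : 0 < ε)
    simp only [hA, hR, Function.comp_apply]
    rw [integral_one_sub_cos, Complex.div_ofReal_re]
    simp
    field_simp
    ring
  have hBlim : ∀ n, Tendsto (B n) (𝓝[>] 0) (𝓝 (I * c * c' / 2 * secondDiffMulLog n)) := by
    intro n
    have h := ((hR0 (n + 1)).sub (((hR0 (n + 2)).add (hR0 n)).div_const 2)).const_add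
      (I * c * c' / 2 * secondDiffMulLog n)
    simp only [add_zero, zero_div, sub_zero] at h
    refine h.congr' ?_
    filter_upwards [self_mem_nhdsWithin] with ε (hε : 0 < ε)
    have hε' : (ε : ℂ) ≠ 0 := by exact_mod_cast hε.ne'
    simp only [hB, hR]
    rw [integral_one_sub_cos_mul_exp_pow]
    simp only [secondDiffMulLog]
    push_cast
    field_simp
    ring
  have hBA : ∀ n, ∀ ε > 0, ‖B n ε‖ ≤ A ε := by
    intro n ε hε
    simp only [hA, hB]
    rw [norm_div, Complex.norm_real, Real.norm_of_nonneg hε.le]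
    gcongr
    refine (norm_integral_le_integral_norm _).trans (le_of_eq ?_)
    congr 1
    funext x
    have : I * ε * x = ((ε * x : ℝ) : ℂ) * I := by push_cast; ring
    rw [norm_mul, norm_pow, this, Complex.norm_exp_ofReal_mul_I, one_pow, mul_one,
      Complex.norm_real, Real.norm_of_nonneg (sub_nonneg.2 (Real.cos_le_one _))]
  have hgeo : Summable fun n : ℕ => ‖w‖ ^ (n + 1) * (c + 1) :=
    ((summable_nat_add_iff 1).2 (summable_geometric_of_lt_one (norm_nonneg w) hw)).mul_right _
  have hsum : Tendsto (fun ε => ∑' n : ℕ, w ^ (n + 1) * B n ε) (𝓝[>] 0)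
      (𝓝 (∑' n : ℕ, w ^ (n + 1) * (I * c * c' / 2 * secondDiffMulLog n))) := by
    refine tendsto_tsum_of_dominated_convergence hgeo (fun n => (hBlim n).const_mul _) ?_
    filter_upwards [self_mem_nhdsWithin, hAlim.eventually (gt_mem_nhds (lt_add_one c))]
      with ε (hε : 0 < ε) hlt n
    rw [norm_mul, norm_pow]
    gcongr
    exact (hBA n ε hε).trans hlt.le
  have hlim := hAlim.add (((Complex.continuous_re.tendsto _).comp hsum).const_mul 2)
  have hnonneg := ge_of_tendsto hlim (b := 0) (by
    filter_upwards [self_mem_nhdsWithin] with ε (hε : 0 < ε)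
    have h := div_nonneg (integral_one_sub_cos_poisson_nonneg μ ε hw) hε.le
    rw [add_div, mul_div_assoc, ← Complex.div_ofReal_re, ← tsum_div_const] at h
    simpa only [hA, hB, Function.comp_apply, mul_div_assoc] using h)
  have hfac : ∑' n : ℕ, w ^ (n + 1) * (I * c * c' / 2 * secondDiffMulLog n) =
      ((c * c' / 2 : ℝ) : ℂ) * (I * ∑' n : ℕ, (secondDiffMulLog n : ℂ) * w ^ (n + 1)) := by
    rw [← tsum_mul_left, ← tsum_mul_left]
    refine tsum_congr fun n => ?_
    push_cast
    ring
  rw [hfac, Complex.re_ofReal_mul, Complex.I_mul_re] at hnonneg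
  refine le_of_mul_le_mul_left ?_ hc
  linarith

theorem stmt17 (c y c' : ℝ) (hc : 0 < c)
    (μ : Measure ℝ) [IsProbabilityMeasure μ]
    (hφ : ∀ t : ℝ, t ≠ 0 → charFun' μ t =
      Complex.exp (Complex.I * y * t -
        (c : ℂ) * (((|t| : ℝ) : ℂ) + Complex.I * c' * t * Real.log |t|)))
    (hφ0 : charFun' μ 0 = 1) :
    |c'| ≤ 2 / Real.pi := by
  have hφ' : ∀ t : ℝ, 0 ≤ t → charFun' μ t =
      cexp (I * y * t - c * (t + I * c' * t * Real.log t)) := by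
    intro t ht
    rcases ht.eq_or_lt with rfl | ht
    · simpa using hφ0
    · rw [hφ t ht.ne', abs_of_pos ht]
  set S : ℂ → ℂ := fun w => ∑' n : ℕ, (secondDiffMulLog n : ℂ) * w ^ (n + 1) with hS
  have hconj : ∀ w, (S (starRingEnd ℂ w)).im = -(S w).im := by
    intro w
    rw [← Complex.conj_im, hS, Complex.conj_tsum]
    simp
  have habs : ∀ w : ℂ, ‖w‖ < 1 → |c'| * (S w).im ≤ 1 := by
    intro w hw
    have h1 := mul_im_tsum_secondDiffMulLog_le_one c y c' hc μ hφ' hw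
    have h2 := mul_im_tsum_secondDiffMulLog_le_one c y c' hc μ hφ'
      (w := starRingEnd ℂ w) (by rwa [Complex.norm_conj])
    change c' * (S w).im ≤ 1 at h1
    change c' * (S (starRingEnd ℂ w)).im ≤ 1 at h2
    rw [hconj] at h2
    rcases abs_choice c' with h | h <;> rw [h] <;> linarith
  have hle := le_of_tendsto (tendsto_im_tsum_secondDiffMulLog.const_mul |c'|) (b := 1) (by
    filter_upwards [Ioo_mem_nhdsGT (one_pos (α := ℝ))] with s hs
    exact habs _ (norm_tangential_path_lt_one hs))
  rw [le_div_iff₀ Real.pi_pos]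
  linarith
end
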